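/- arXiv:math/9809128 — 3 statements merged into one kernel-verified Lean document; each statement's English description precedes it below -/
import Mathlib

section
/- Let r ≥ 2 and s ≥ 1, let μ be the rectangular partition of n+1 = rs consisting of s parts equal to r, and let ν be the partition of n = rs−1 consisting of s−1 parts equal to r and one part equal to r−1 (i.e. ν is obtained from μ by removing its unique corner cell). If dim_ℚ M_ν = n!, then dim_ℚ M_μ = (n+1)!. -/
open MvPolynomial

/-- The Garsia–Haiman determinant `Δ_μ`: given a set `cells` of (0-indexed) cells
`(i,j)` of the diagram of a partition (row index `i`, column index `j`), and an
enumeration `e` of the cells by `Fin n`, it is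
`det ‖ x_r ^ (i-coordinate of cell c) * y_r ^ (j-coordinate of cell c) ‖`. -/
noncomputable def Delta (n : ℕ) (cells : Finset (ℕ × ℕ))
    (e : Fin n ≃ {c // c ∈ cells}) : MvPolynomial (Fin n ⊕ Fin n) ℚ :=
  Matrix.det (Matrix.of fun r c : Fin n =>
    X (Sum.inl r) ^ ((e c).val.1) * X (Sum.inr r) ^ ((e c).val.2))

/-- The linear span of a polynomial `Δ` together with all of its partial
derivatives of all orders. -/
noncomputable def derivSpan (n : ℕ) (Δ : MvPolynomial (Fin n ⊕ Fin n) ℚ) :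
    Submodule ℚ (MvPolynomial (Fin n ⊕ Fin n) ℚ) :=
  Submodule.span ℚ
    {P | ∃ L : List (Fin n ⊕ Fin n), P = L.foldr (fun v Q => pderiv v Q) Δ}

/-- The Garsia–Haiman module `M_μ`. -/
noncomputable def GHmodule (n : ℕ) (cells : Finset (ℕ × ℕ))
    (e : Fin n ≃ {c // c ∈ cells}) : Submodule ℚ (MvPolynomial (Fin n ⊕ Fin n) ℚ) :=
  derivSpan n (Delta n cells e)


lemma gh_hc_pderiv {σ : Type*} (v : σ) (P : MvPolynomial σ ℚ) (j : ℕ) :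
    homogeneousComponent j (pderiv v P) = pderiv v (homogeneousComponent (j+1) P) := by
  ext m
  simp only [coeff_homogeneousComponent, coeff_pderiv, map_add, Finsupp.degree_single,
    add_left_inj]
  split_ifs <;> simp

lemma gh_coeff_X_pderiv {σ : Type*} (v : σ) (P : MvPolynomial σ ℚ) (m : σ →₀ ℕ) :
    coeff m (X v * pderiv v P) = m v * coeff m P := by
  classical
  induction P using MvPolynomial.induction_on' with
  | monomial u a =>
    rw [X_mul_pderiv_monomial, coeff_smul, coeff_monomial]
    split_ifs with h
    · subst h; simp
    · simp
  | add p q hp hq => rw [map_add, mul_add, coeff_add, hp, hq, coeff_add]; ring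

lemma gh_hc_euler {σ : Type*} (v : σ) (P : MvPolynomial σ ℚ) (j : ℕ) :
    homogeneousComponent j (X v * pderiv v P) = X v * pderiv v (homogeneousComponent j P) := by
  ext m
  simp only [coeff_homogeneousComponent, gh_coeff_X_pderiv]
  split_ifs <;> simp

lemma gh_hc_word {σ : Type*} (Δ : MvPolynomial σ ℚ) (d : ℕ)
    (hΔ : ∀ j, homogeneousComponent j Δ = if j = d then Δ else 0) (L : List σ) (j : ℕ) :
    homogeneousComponent j (L.foldr (fun v Q => pderiv v Q) Δ)
      = if j + L.length = d then L.foldr (fun v Q => pderiv v Q) Δ else 0 := by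
  induction L generalizing j with
  | nil => simpa using hΔ j
  | cons v L ih =>
    simp only [List.foldr_cons, List.length_cons, gh_hc_pderiv, ih]
    have : j + 1 + L.length = j + (L.length + 1) := by ring
    rw [this]
    split_ifs <;> simp

lemma gh_hc_wordD {σ : Type*} (Δ : MvPolynomial σ ℚ) (d : ℕ)
    (hΔ : ∀ j, homogeneousComponent j Δ = if j = d then Δ else 0) (L : List σ) (j : ℕ)
    (hj : j + L.length ≤ d) :
    homogeneousComponent j (L.foldr (fun v Q => pderiv v Q + X v * pderiv v Q) Δ)
      = if j + L.length = d then L.foldr (fun v Q => pderiv v Q) Δ else 0 := by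
  induction L generalizing j with
  | nil => simpa using hΔ j
  | cons v L ih =>
    simp only [List.length_cons] at hj
    simp only [List.foldr_cons, List.length_cons, map_add, gh_hc_pderiv, gh_hc_euler]
    rw [ih (j+1) (by omega), ih j (by omega)]
    have : j + 1 + L.length = j + (L.length + 1) := by ring
    rw [this, if_neg (show ¬ (j + L.length = d) by omega)]
    split_ifs <;> simp

lemma gh_dim_le {σ : Type} (Δ : MvPolynomial σ ℚ) (d : ℕ)
    (hΔ : ∀ j, homogeneousComponent j Δ = if j = d then Δ else 0)
    (W : Submodule ℚ (MvPolynomial σ ℚ)) [FiniteDimensional ℚ W]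
    (hW : ∀ L : List σ, L.foldr (fun v Q => pderiv v Q + X v * pderiv v Q) Δ ∈ W) :
    FiniteDimensional ℚ (Submodule.span ℚ
      {P | ∃ L : List σ, P = L.foldr (fun v Q => pderiv v Q) Δ}) ∧
    Module.finrank ℚ (Submodule.span ℚ
      {P | ∃ L : List σ, P = L.foldr (fun v Q => pderiv v Q) Δ}) ≤ Module.finrank ℚ W := by
  classical
  have hset : {P | ∃ L : List σ, P = L.foldr (fun v Q => pderiv v Q) Δ} =
      Set.range (fun L : List σ => L.foldr (fun v Q => pderiv v Q) Δ) := by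
    ext P; simp [eq_comm]
  rw [hset]
  obtain ⟨κ, a, ha, hspan, hli⟩ := exists_linearIndependent' ℚ
    (fun L : List σ => L.foldr (fun v Q => pderiv v Q) Δ)
  rw [← hspan]
  have hli2 : LinearIndependent ℚ
      (fun k : κ => (⟨_, hW (a k)⟩ : W)) := by
    apply LinearIndependent.of_comp W.subtype
    rw [linearIndependent_iff']
    intro s g hg
    by_contra hcon
    push Not at hcon
    obtain ⟨i1, hi1, hgi1⟩ := hcon
    obtain ⟨i0, hi0, hmax⟩ := Finset.exists_max_image (s.filter (fun i => g i ≠ 0))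
      (fun i => (a i).length) ⟨i1, by simp [hi1, hgi1]⟩
    simp only [Finset.mem_filter] at hi0 hmax
    have hk : (a i0).length ≤ d := by
      by_contra hk
      apply hli.ne_zero i0
      have : ∀ j, homogeneousComponent j ((a i0).foldr (fun v Q => pderiv v Q) Δ) = 0 := by
        intro j
        rw [gh_hc_word Δ d hΔ, if_neg (by omega)]
      have h2 := sum_homogeneousComponent ((a i0).foldr (fun v Q => pderiv v Q) Δ)
      rw [Finset.sum_eq_zero (fun j _ => this j)] at h2
      exact h2.symm
    have h3 := congrArg (homogeneousComponent (d - (a i0).length)) hg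
    rw [map_sum, map_zero] at h3
    have h4 : ∑ i ∈ s, (if (a i).length = (a i0).length then g i else 0) •
        ((fun L : List σ => L.foldr (fun v Q => pderiv v Q) Δ) ∘ a) i = 0 := by
      rw [← h3]
      refine Finset.sum_congr rfl fun i hi => ?_
      by_cases hgi : g i = 0
      · simp [hgi]
      · have hle := hmax i ⟨hi, hgi⟩
        simp only [Function.comp, Submodule.subtype_apply, map_smul]
        rw [gh_hc_wordD Δ d hΔ _ _ (by omega)]
        by_cases he : (a i).length = (a i0).length
        · rw [if_pos he, if_pos (by omega)]
        · rw [if_neg he, if_neg (by omega)]; simp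
    have h5 := linearIndependent_iff'.1 hli s _ h4 i0 hi0.1
    simp at h5
    exact hi0.2 h5
  have : Finite κ := hli2.finite
  have := Fintype.ofFinite κ
  refine ⟨FiniteDimensional.span_of_finite ℚ (Set.finite_range _), ?_⟩
  rw [finrank_span_eq_card hli]
  exact hli2.fintype_card_le_finrank

lemma gh_nilp {V : Type*} [AddCommGroup V] [Module ℚ V] (T : Module.End ℚ V) (U : Submodule ℚ V)
    [FiniteDimensional ℚ U] (hU : U ≤ U.comap T) (s : ℕ) (hs : 1 ≤ s) (hT : ∀ u ∈ U, (T ^ s) u = 0) :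
    s * Module.finrank ℚ (U.map (T ^ (s-1))) ≤ Module.finrank ℚ U := by
  have hinv : ∀ k, ∀ u ∈ U, (T ^ k) u ∈ U := by
    intro k
    induction k with
    | zero => intro u hu; simpa using hu
    | succ k ih => intro u hu; rw [pow_succ', Module.End.mul_apply]; exact hU (ih u hu)
  have step : ∀ i, i < s → Module.finrank ℚ (U.map (T ^ (i+1))) +
      Module.finrank ℚ (U.map (T ^ (s-1))) ≤ Module.finrank ℚ (U.map (T ^ i)) := by
    intro i hi
    set A := U.map (T ^ i) with hA
    have h1 := (T.domRestrict A).finrank_range_add_finrank_ker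
    have h2 : LinearMap.range (T.domRestrict A) = U.map (T ^ (i+1)) := by
      rw [LinearMap.range_domRestrict, hA, ← Submodule.map_comp, pow_succ']; rfl
    have hKA : U.map (T ^ (s-1)) ≤ A := by
      rintro _ ⟨u, hu, rfl⟩
      refine ⟨(T ^ (s-1-i)) u, hinv _ u hu, ?_⟩
      rw [← Module.End.mul_apply, ← pow_add]
      congr 2; omega
    have h3 : (U.map (T ^ (s-1))).comap A.subtype ≤ LinearMap.ker (T.domRestrict A) := by
      rintro ⟨x, hx⟩ ⟨u, hu, hux⟩
      simp only [Submodule.subtype_apply] at hux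
      simp only [LinearMap.mem_ker, LinearMap.domRestrict_apply]
      rw [← hux, ← Module.End.mul_apply, ← pow_succ', Nat.sub_add_cancel hs]
      exact hT u hu
    have h4 := Submodule.finrank_mono h3
    rw [(Submodule.comapSubtypeEquivOfLe hKA).finrank_eq] at h4
    rw [h2] at h1
    omega
  have main : ∀ i, i ≤ s → Module.finrank ℚ (U.map (T ^ i)) +
      i * Module.finrank ℚ (U.map (T ^ (s-1))) ≤ Module.finrank ℚ U := by
    intro i
    induction i with
    | zero => intro _; simpa using Submodule.finrank_map_le (T ^ 0) U
    | succ i ih =>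
      intro hi
      have := ih (by omega)
      have := step i (by omega)
      rw [add_mul]; omega
  have := main s le_rfl
  omega

noncomputable def ghTau (σ : Type) : MvPolynomial σ ℚ →ₐ[ℚ] MvPolynomial σ ℚ :=
  aeval (fun v => X v + 1)

lemma ghTau_inj (σ : Type) : Function.Injective (ghTau σ) := by
  have h : (aeval (fun v => X v - 1) : MvPolynomial σ ℚ →ₐ[ℚ] MvPolynomial σ ℚ).comp (ghTau σ)
      = AlgHom.id ℚ _ := by
    ext v; simp [ghTau]
  intro a b hab
  have := congrArg (aeval (fun v => X v - 1) : MvPolynomial σ ℚ →ₐ[ℚ] MvPolynomial σ ℚ) hab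
  have h1 := DFunLike.congr_fun h a
  have h2 := DFunLike.congr_fun h b
  simp only [AlgHom.comp_apply, AlgHom.id_apply] at h1 h2
  rw [← h1, ← h2, this]

lemma gh_pderiv_tau {σ : Type} (v : σ) (P : MvPolynomial σ ℚ) :
    pderiv v (ghTau σ P) = ghTau σ (pderiv v P) := by
  classical
  induction P using MvPolynomial.induction_on with
  | C a => simp [ghTau]
  | add p q hp hq => simp [hp, hq]
  | mul_X p i hp =>
    have : ghTau σ (X i) = X i + 1 := by simp [ghTau]
    rw [map_mul, pderiv_mul, pderiv_mul, map_add, map_mul, map_mul, hp, this, map_add, pderiv_one,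
      pderiv_X, add_zero]
    congr 2
    by_cases h : i = v
    · subst h; simp
    · simp [Pi.single_apply, h]

lemma gh_word_tau {σ : Type} (P : MvPolynomial σ ℚ) (L : List σ) :
    L.foldr (fun v Q => pderiv v Q + X v * pderiv v Q) (ghTau σ P) =
      ghTau σ (L.foldr (fun v Q => X v * pderiv v Q) P) := by
  induction L with
  | nil => rfl
  | cons v L ih =>
    simp only [List.foldr_cons, ih, gh_pderiv_tau, map_mul]
    have : ghTau σ (X v) = X v + 1 := by simp [ghTau]
    rw [this]; ring

lemma gh_word_smul {σ : Type} (c : ℚ) (P : MvPolynomial σ ℚ) (L : List σ) :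
    L.foldr (fun v Q => pderiv v Q + X v * pderiv v Q) (c • P) =
      c • (L.foldr (fun v Q => pderiv v Q + X v * pderiv v Q) P) := by
  induction L with
  | nil => rfl
  | cons v L ih =>
    simp only [List.foldr_cons, ih, Derivation.map_smul, smul_add, mul_smul_comm]

lemma gh_add_pow {R : Type*} [CommRing R] (x : R) (p s : ℕ) (h : p < s) :
    (x + 1) ^ p = ∑ k ∈ Finset.range s, x ^ k * (p.choose k : R) := by
  rw [add_pow]
  simp only [one_pow, mul_one]
  apply Finset.sum_subset
  · intro k hk; simp at hk ⊢; omega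
  · intro k _ hk
    simp at hk
    rw [Nat.choose_eq_zero_of_lt (by omega)]; simp

lemma gh_tau_Delta (N r s : ℕ)
    (e : Fin N ≃ {c // c ∈ Finset.range s ×ˢ Finset.range r}) :
    ∃ c : ℚ, ghTau _ (Delta N _ e) = c • Delta N _ e := by
  let T : Matrix (Fin N) (Fin N) ℚ := Matrix.of fun c' c =>
    (((e c).val.1.choose (e c').val.1 : ℕ) : ℚ) * (((e c).val.2.choose (e c').val.2 : ℕ) : ℚ)
  refine ⟨T.det, ?_⟩
  have hT : C T.det = (T.map (C : ℚ →+* MvPolynomial (Fin N ⊕ Fin N) ℚ)).det := by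
    rw [RingHom.map_det]; rfl
  rw [← C_mul', hT, mul_comm]
  unfold Delta
  rw [← Matrix.det_mul, AlgHom.map_det]
  congr 1
  ext1 i j
  have hj := (e j).2
  simp only [Finset.mem_product, Finset.mem_range] at hj
  simp only [AlgHom.mapMatrix_apply, Matrix.map_apply, Matrix.of_apply, map_mul, map_pow,
    Matrix.mul_apply, T]
  have h1 : ∀ v : Fin N ⊕ Fin N, ghTau _ (X v) = X v + 1 := by intro v; simp [ghTau]
  rw [h1, h1, gh_add_pow _ _ s hj.1, gh_add_pow _ _ r hj.2, Finset.sum_mul_sum,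
    ← Finset.sum_product', ← Finset.sum_coe_sort, ← Equiv.sum_comp e]
  refine Finset.sum_congr rfl fun k _ => ?_
  simp only [map_natCast]
  ring

lemma gh_Delta_sum (N : ℕ) (cells : Finset (ℕ × ℕ)) (e : Fin N ≃ {c // c ∈ cells}) :
    Delta N cells e = ∑ w : Equiv.Perm (Fin N), Equiv.Perm.sign w •
      ∏ i, (X (Sum.inl (w i)) ^ (e i).val.1 * X (Sum.inr (w i)) ^ (e i).val.2) := by
  unfold Delta
  rw [Matrix.det_apply]
  rfl

lemma gh_Delta_hom (N : ℕ) (cells : Finset (ℕ × ℕ)) (e : Fin N ≃ {c // c ∈ cells}) :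
    (Delta N cells e).IsHomogeneous (∑ i, ((e i).val.1 + (e i).val.2)) := by
  rw [gh_Delta_sum]
  apply IsHomogeneous.sum
  intro w _
  have h : (∏ i, (X (Sum.inl (w i)) ^ (e i).val.1 * X (Sum.inr (w i)) ^ (e i).val.2) :
      MvPolynomial (Fin N ⊕ Fin N) ℚ).IsHomogeneous (∑ i, ((e i).val.1 + (e i).val.2)) := by
    apply IsHomogeneous.prod
    intro i _
    exact (isHomogeneous_X_pow _ _).mul (isHomogeneous_X_pow _ _)
  rcases Int.units_eq_one_or (Equiv.Perm.sign w) with h1 | h1 <;> rw [h1]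
  · simpa using h
  · simpa [Units.smul_def] using h.neg

lemma gh_upper (N r s : ℕ)
    (e : Fin N ≃ {c // c ∈ Finset.range s ×ˢ Finset.range r}) :
    FiniteDimensional ℚ (GHmodule N _ e) ∧
    Module.finrank ℚ (GHmodule N _ e) ≤ N.factorial := by
  classical
  let b : Equiv.Perm (Fin N) → MvPolynomial (Fin N ⊕ Fin N) ℚ := fun w =>
    ∏ i, (X (Sum.inl (w i)) ^ (e i).val.1 * X (Sum.inr (w i)) ^ (e i).val.2)
  have hb : ∀ w, ∃ m, b w = monomial m (1 : ℚ) := by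
    intro w
    refine ⟨∑ i, (Finsupp.single (Sum.inl (w i)) (e i).val.1 +
      Finsupp.single (Sum.inr (w i)) (e i).val.2), ?_⟩
    rw [monomial_sum_one]
    refine Finset.prod_congr rfl fun i _ => ?_
    rw [X_pow_eq_monomial, X_pow_eq_monomial, monomial_mul, one_mul]
  let W0 : Submodule ℚ (MvPolynomial (Fin N ⊕ Fin N) ℚ) := Submodule.span ℚ (Set.range b)
  have hE : ∀ v, ∀ P ∈ W0, X v * pderiv v P ∈ W0 := by
    intro v P hP
    induction hP using Submodule.span_induction with
    | mem x hx =>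
      obtain ⟨w, rfl⟩ := hx
      obtain ⟨m, hm⟩ := hb w
      rw [hm, X_mul_pderiv_monomial, ← hm]
      exact W0.smul_of_tower_mem _ (Submodule.subset_span ⟨w, rfl⟩)
    | zero => simp
    | add x y _ _ hx hy => rw [map_add, mul_add]; exact W0.add_mem hx hy
    | smul a x _ hx => rw [Derivation.map_smul, mul_smul_comm]; exact W0.smul_mem _ hx
  have hD : Delta N _ e ∈ W0 := by
    rw [gh_Delta_sum]
    refine W0.sum_mem fun w _ => ?_
    exact W0.smul_of_tower_mem _ (Submodule.subset_span ⟨w, rfl⟩)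
  have hword : ∀ L : List (Fin N ⊕ Fin N),
      L.foldr (fun v Q => X v * pderiv v Q) (Delta N _ e) ∈ W0 := by
    intro L
    induction L with
    | nil => exact hD
    | cons v L ih => exact hE v _ ih
  have hfin : FiniteDimensional ℚ W0 :=
    FiniteDimensional.span_of_finite ℚ (Set.finite_range b)
  have hW0 : Module.finrank ℚ W0 ≤ N.factorial := by
    have := finrank_range_le_card (R := ℚ) b
    rw [Fintype.card_perm, Fintype.card_fin] at this
    exact this
  obtain ⟨c, hc⟩ := gh_tau_Delta N r s e
  by_cases h0 : Delta N _ e = 0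
  · have : GHmodule N _ e = ⊥ := by
      unfold GHmodule derivSpan
      rw [Submodule.span_eq_bot]
      rintro P ⟨L, rfl⟩
      rw [h0]
      induction L with
      | nil => rfl
      | cons v L ih => simp [ih]
    rw [this]
    exact ⟨inferInstance, by simp⟩
  have hc0 : c ≠ 0 := by
    rintro rfl
    rw [zero_smul] at hc
    exact h0 (ghTau_inj _ (by rw [hc, map_zero]))
  let W := W0.map (ghTau (Fin N ⊕ Fin N)).toLinearMap
  have hmem : ∀ L : List (Fin N ⊕ Fin N),
      L.foldr (fun v Q => pderiv v Q + X v * pderiv v Q) (Delta N _ e) ∈ W := by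
    intro L
    have h1 := gh_word_tau (Delta N _ e) L
    rw [hc, gh_word_smul] at h1
    have h2 : c • (L.foldr (fun v Q => pderiv v Q + X v * pderiv v Q) (Delta N _ e)) ∈ W := by
      rw [h1]
      exact ⟨_, hword L, rfl⟩
    exact (W.smul_mem_iff hc0).1 h2
  have := gh_dim_le (Delta N _ e) (∑ i, ((e i).val.1 + (e i).val.2)) (fun j => by
    rw [homogeneousComponent_of_mem (gh_Delta_hom N _ e)]) W hmem
  refine ⟨this.1, this.2.trans ((Submodule.finrank_map_le _ _).trans hW0)⟩

lemma gh_pderiv_comm {σ : Type*} (u v : σ) (P : MvPolynomial σ ℚ) :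
    pderiv u (pderiv v P) = pderiv v (pderiv u P) := by
  classical
  ext m
  simp only [coeff_pderiv]
  by_cases h : u = v
  · subst h; rfl
  · simp only [Finsupp.add_apply, Finsupp.single_apply, h, Ne.symm h, if_false, add_zero]
    rw [add_right_comm]; ring

/-- Partial derivative as a linear endomorphism. -/
noncomputable def ghD {σ : Type*} (v : σ) : Module.End ℚ (MvPolynomial σ ℚ) :=
  (pderiv v).toLinearMap

lemma ghD_apply {σ : Type*} (v : σ) (P : MvPolynomial σ ℚ) : ghD v P = pderiv v P := rfl

lemma ghD_comm {σ : Type*} (u v : σ) : Commute (ghD u) (ghD v) := by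
  apply LinearMap.ext
  intro P
  exact gh_pderiv_comm u v P

lemma gh_iter {σ : Type*} (v : σ) (g : MvPolynomial σ ℚ) (hg : pderiv v g = 0) (p a : ℕ) :
    (ghD v ^ a) (X v ^ p * g) = (p.descFactorial a : ℚ) • (X v ^ (p - a) * g) := by
  induction a with
  | zero => simp
  | succ a ih =>
    rw [pow_succ', Module.End.mul_apply, ih, map_smul, ghD_apply, pderiv_mul, hg, pderiv_pow,
      pderiv_X_self, Nat.descFactorial_succ, Nat.sub_sub]
    simp only [mul_one, mul_zero, add_zero, Nat.cast_mul]
    rw [mul_comm ((p - a : ℕ) : ℚ), mul_smul]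
    congr 1
    rw [mul_assoc, ← nsmul_eq_mul, ← Nat.cast_smul_eq_nsmul ℚ]

lemma gh_word_End {σ : Type*} (T : Module.End ℚ (MvPolynomial σ ℚ))
    (hT : ∀ v, Commute T (ghD v)) (P : MvPolynomial σ ℚ) (L : List σ) :
    T (L.foldr (fun v Q => pderiv v Q) P) = L.foldr (fun v Q => pderiv v Q) (T P) := by
  induction L with
  | nil => rfl
  | cons v L ih =>
    simp only [List.foldr_cons]
    rw [← ih]
    exact LinearMap.congr_fun (hT v) _

lemma gh_word_rename {σ τ : Type*} (f : σ → τ) (hf : Function.Injective f)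
    (P : MvPolynomial σ ℚ) (L : List σ) :
    rename f (L.foldr (fun v Q => pderiv v Q) P) =
      (L.map f).foldr (fun v Q => pderiv v Q) (rename f P) := by
  induction L with
  | nil => rfl
  | cons v L ih => simp only [List.foldr_cons, List.map_cons, ← ih, pderiv_rename hf]

/-- The minor of the determinant obtained by deleting the last row and the column `j`. -/
noncomputable def ghMinor (n : ℕ) (f : Fin (n+1) → ℕ × ℕ) (j : Fin (n+1)) :
    MvPolynomial (Fin n ⊕ Fin n) ℚ :=
  Matrix.det (Matrix.of fun i k : Fin n =>
    X (Sum.inl i) ^ (f (j.succAbove k)).1 * X (Sum.inr i) ^ (f (j.succAbove k)).2)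

/-- The inclusion of variables. -/
def ghIota (n : ℕ) : Fin n ⊕ Fin n → Fin (n+1) ⊕ Fin (n+1) := Sum.map Fin.castSucc Fin.castSucc

lemma ghIota_inj (n : ℕ) : Function.Injective (ghIota n) :=
  Sum.map_injective.2 ⟨Fin.castSucc_injective n, Fin.castSucc_injective n⟩

lemma gh_expand (n : ℕ) (cells : Finset (ℕ × ℕ)) (e : Fin (n+1) ≃ {c // c ∈ cells}) :
    Delta (n+1) cells e = ∑ j : Fin (n+1), ((-1 : ℚ) ^ (n + j : ℕ)) •
      (X (Sum.inl (Fin.last n)) ^ (e j).val.1 * (X (Sum.inr (Fin.last n)) ^ (e j).val.2 *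
        rename (ghIota n) (ghMinor n (fun k => (e k).val) j))) := by
  unfold Delta
  rw [Matrix.det_succ_row _ (Fin.last n)]
  refine Finset.sum_congr rfl fun j _ => ?_
  have : rename (ghIota n) (ghMinor n (fun k => (e k).val) j) =
      Matrix.det ((Matrix.of fun r c : Fin (n+1) =>
        (X (Sum.inl r) ^ ((e c).val.1) * X (Sum.inr r) ^ ((e c).val.2) :
          MvPolynomial (Fin (n+1) ⊕ Fin (n+1)) ℚ)).submatrix
        (Fin.last n).succAbove j.succAbove) := by
    unfold ghMinor
    rw [AlgHom.map_det]
    congr 1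
    ext1 i k
    simp [ghIota]
  rw [this, Matrix.of_apply, ← C_mul']
  simp only [Fin.val_last, map_pow, map_neg, map_one]
  ring

lemma gh_pderiv_rename_zero (n : ℕ) (v : Fin (n+1) ⊕ Fin (n+1)) (hv : v ∉ Set.range (ghIota n))
    (g : MvPolynomial (Fin n ⊕ Fin n) ℚ) : pderiv v (rename (ghIota n) g) = 0 := by
  classical
  apply pderiv_eq_zero_of_notMem_vars
  intro h
  have := vars_rename (ghIota n) g h
  rw [Finset.mem_image] at this
  obtain ⟨a, _, ha⟩ := this
  exact hv ⟨a, ha⟩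

lemma gh_last_inl (n : ℕ) : Sum.inl (Fin.last n) ∉ Set.range (ghIota n) := by
  rintro ⟨a | a, h⟩ <;> simp [ghIota, Fin.castSucc_ne_last] at h

lemma gh_last_inr (n : ℕ) : Sum.inr (Fin.last n) ∉ Set.range (ghIota n) := by
  rintro ⟨a | a, h⟩ <;> simp [ghIota, Fin.castSucc_ne_last] at h

lemma gh_term (n : ℕ) (p q a b : ℕ) (g : MvPolynomial (Fin n ⊕ Fin n) ℚ) :
    (ghD (Sum.inr (Fin.last n)) ^ b) ((ghD (Sum.inl (Fin.last n)) ^ a)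
      (X (Sum.inl (Fin.last n)) ^ p * (X (Sum.inr (Fin.last n)) ^ q * rename (ghIota n) g))) =
    ((p.descFactorial a : ℚ) * (q.descFactorial b : ℚ)) •
      (X (Sum.inl (Fin.last n)) ^ (p - a) * (X (Sum.inr (Fin.last n)) ^ (q - b) *
        rename (ghIota n) g)) := by
  rw [gh_iter _ _ (by
    rw [pderiv_mul, pderiv_pow, pderiv_X_of_ne (by simp),
      gh_pderiv_rename_zero n _ (gh_last_inl n)]; simp), map_smul, mul_left_comm, gh_iter _ _ (by
    rw [pderiv_mul, pderiv_pow, pderiv_X_of_ne (by simp),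
      gh_pderiv_rename_zero n _ (gh_last_inr n)]; simp), smul_smul]
  congr 1
  ring

lemma gh_minor_eq (n r s : ℕ) (hr : 1 ≤ r) (hs : 1 ≤ s)
    (eμ : Fin (n+1) ≃ {c // c ∈ Finset.range s ×ˢ Finset.range r})
    (eν : Fin n ≃ {c // c ∈ (Finset.range s ×ˢ Finset.range r).erase (s - 1, r - 1)})
    (j : Fin (n+1)) (hj : (eμ j).val = (s-1, r-1)) :
    ∃ c : ℚ, c ≠ 0 ∧ ghMinor n (fun k => (eμ k).val) j = c • Delta n _ eν := by
  classical
  have hmem : ∀ k : Fin n, (eμ (j.succAbove k)).val ∈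
      (Finset.range s ×ˢ Finset.range r).erase (s - 1, r - 1) := by
    intro k
    rw [Finset.mem_erase]
    refine ⟨?_, (eμ (j.succAbove k)).2⟩
    rw [← hj]
    intro h
    exact Fin.succAbove_ne j k (eμ.injective (Subtype.ext h))
  let π : Fin n → Fin n := fun k => eν.symm ⟨_, hmem k⟩
  have hπ : Function.Injective π := by
    intro a b hab
    have := congrArg Subtype.val (eν.symm.injective hab)
    exact Fin.succAbove_right_injective (eμ.injective (Subtype.ext this))
  let w : Equiv.Perm (Fin n) := Equiv.ofBijective π (Finite.injective_iff_bijective.1 hπ)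
  have hw : ∀ k, (eν (w k)).val = (eμ (j.succAbove k)).val := by
    intro k
    simp [w, π]
  refine ⟨((Equiv.Perm.sign w : ℤ) : ℚ), by simp, ?_⟩
  unfold ghMinor Delta
  rw [← C_mul', map_intCast, ← Matrix.det_permute']
  congr 1
  ext1 i k
  simp [hw]

lemma gh_lower (n r s : ℕ) (hr : 1 ≤ r) (hs : 1 ≤ s)
    (eμ : Fin (n+1) ≃ {c // c ∈ Finset.range s ×ˢ Finset.range r})
    (eν : Fin n ≃ {c // c ∈ (Finset.range s ×ˢ Finset.range r).erase (s - 1, r - 1)})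
    (hfin : FiniteDimensional ℚ (GHmodule (n+1) _ eμ)) :
    s * (r * Module.finrank ℚ (GHmodule n _ eν)) ≤ Module.finrank ℚ (GHmodule (n+1) _ eμ) := by
  classical
  have hbd : ∀ j, (eμ j).val.1 < s ∧ (eμ j).val.2 < r := by
    intro j
    have := (eμ j).2
    simpa only [Finset.mem_product, Finset.mem_range] using this
  set A : Module.End ℚ (MvPolynomial (Fin (n+1) ⊕ Fin (n+1)) ℚ) :=
    ghD (Sum.inl (Fin.last n)) with hA
  set B : Module.End ℚ (MvPolynomial (Fin (n+1) ⊕ Fin (n+1)) ℚ) :=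
    ghD (Sum.inr (Fin.last n)) with hB
  set V := GHmodule (n+1) _ eμ with hV
  have hAB : Commute B A := ghD_comm _ _
  -- general facts on `V`
  have hinv : ∀ v, V ≤ V.comap (ghD v) := by
    intro v
    rw [hV, GHmodule, derivSpan, Submodule.span_le]
    rintro P ⟨L, rfl⟩
    exact Submodule.subset_span ⟨v :: L, rfl⟩
  have hkill : ∀ T : Module.End ℚ (MvPolynomial (Fin (n+1) ⊕ Fin (n+1)) ℚ),
      (∀ v, Commute T (ghD v)) → T (Delta (n+1) _ eμ) = 0 → ∀ u ∈ V, T u = 0 := by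
    intro T hT h0
    have : V ≤ LinearMap.ker T := by
      rw [hV, GHmodule, derivSpan, Submodule.span_le]
      rintro P ⟨L, rfl⟩
      simp only [SetLike.mem_coe, LinearMap.mem_ker]
      rw [gh_word_End T hT, h0]
      induction L with
      | nil => rfl
      | cons v L ih => simp [ih]
    exact fun u hu => this hu
  have hcA : ∀ k v, Commute (A ^ k) (ghD v) := fun k v => (ghD_comm _ v).pow_left k
  have hcB : ∀ k v, Commute (B ^ k) (ghD v) := fun k v => (ghD_comm _ v).pow_left k
  have hA0 : (A ^ s) (Delta (n+1) _ eμ) = 0 := by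
    rw [gh_expand, map_sum]
    refine Finset.sum_eq_zero fun j _ => ?_
    have := gh_term n (eμ j).val.1 (eμ j).val.2 s 0 (ghMinor n (fun k => (eμ k).val) j)
    rw [pow_zero, Module.End.one_apply, Nat.descFactorial_of_lt (hbd j).1] at this
    rw [map_smul, this]; simp
  have hB0 : (B ^ r) (Delta (n+1) _ eμ) = 0 := by
    rw [gh_expand, map_sum]
    refine Finset.sum_eq_zero fun j _ => ?_
    have := gh_term n (eμ j).val.1 (eμ j).val.2 0 r (ghMinor n (fun k => (eμ k).val) j)
    rw [pow_zero, Module.End.one_apply, Nat.descFactorial_of_lt (hbd j).2] at this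
    rw [map_smul, this]; simp
  have step1 := gh_nilp A V (hinv _) s hs (hkill _ (hcA s) hA0)
  have step2 := gh_nilp B (V.map (A ^ (s-1))) (by
      rintro _ ⟨u, hu, rfl⟩
      refine ⟨B u, hinv _ hu, ?_⟩
      exact (LinearMap.congr_fun (hAB.pow_right (s-1)) u).symm) r hr (by
      rintro _ ⟨u, hu, rfl⟩
      rw [← Module.End.mul_apply, (hAB.pow_pow r (s-1)).eq, Module.End.mul_apply,
        hkill _ (hcB r) hB0 u hu, map_zero])
  -- the corner
  let j0 : Fin (n+1) := eμ.symm ⟨(s-1, r-1), by simp; omega⟩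
  have hj0 : (eμ j0).val = (s-1, r-1) := by simp [j0]
  obtain ⟨c, hc, hmin⟩ := gh_minor_eq n r s hr hs eμ eν j0 hj0
  have hcorner : ∃ c : ℚ, c ≠ 0 ∧ (B ^ (r-1)) ((A ^ (s-1)) (Delta (n+1) _ eμ)) =
      c • rename (ghIota n) (Delta n _ eν) := by
    refine ⟨(-1) ^ (n + j0 : ℕ) * (((s-1).factorial : ℚ) * ((r-1).factorial : ℚ)) * c, ?_, ?_⟩
    · have := Nat.factorial_ne_zero (s-1)
      have := Nat.factorial_ne_zero (r-1)
      simp [*]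
    · rw [gh_expand, map_sum, map_sum, Finset.sum_eq_single j0]
      · rw [map_smul, map_smul, gh_term, hj0, hmin]
        simp [Nat.descFactorial_self, smul_smul, mul_assoc]
      · intro j _ hj
        rw [map_smul, map_smul, gh_term]
        have hne : (eμ j).val ≠ (s-1, r-1) := by
          rw [← hj0]; intro h; exact hj (eμ.injective (Subtype.ext h))
        have h2 := hbd j
        have h3 : (eμ j).val.1 < s - 1 ∨ (eμ j).val.2 < r - 1 := by
          by_contra hcon
          apply hne
          ext
          · show _ = s - 1
            omega
          · show _ = r - 1
            omega
        rcases h3 with h3 | h3 <;> simp [Nat.descFactorial_of_lt h3]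
      · simp
  obtain ⟨c', hc', hcor⟩ := hcorner
  have hle : (GHmodule n _ eν).map (rename (R := ℚ) (ghIota n)).toLinearMap ≤
      (V.map (A ^ (s-1))).map (B ^ (r-1)) := by
    rw [Submodule.map_le_iff_le_comap]
    conv_lhs => rw [GHmodule, derivSpan]
    rw [Submodule.span_le]
    rintro P ⟨L, rfl⟩
    simp only [SetLike.mem_coe, Submodule.mem_comap, AlgHom.toLinearMap_apply]
    rw [← Submodule.smul_mem_iff _ hc']
    refine ⟨_, ⟨(L.map (ghIota n)).foldr (fun v Q => pderiv v Q) (Delta (n+1) _ eμ),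
      Submodule.subset_span ⟨_, rfl⟩, rfl⟩, ?_⟩
    rw [gh_word_End _ (hcA _), gh_word_End _ (hcB _), hcor, gh_word_rename _ (ghIota_inj n)]
    have := gh_word_End (c' • (1 : Module.End ℚ (MvPolynomial (Fin (n+1) ⊕ Fin (n+1)) ℚ)))
      (fun v => (Commute.one_left _).smul_left c') (rename (ghIota n) (Delta n _ eν))
      (L.map (ghIota n))
    simpa using this.symm
  have h1 := Submodule.finrank_mono hle
  rw [← (Submodule.equivMapOfInjective (rename (R := ℚ) (ghIota n)).toLinearMap
    (rename_injective _ (ghIota_inj n)) (GHmodule n _ eν)).finrank_eq] at h1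
  calc _ ≤ s * (r * _) := by gcongr
    _ ≤ _ := (Nat.mul_le_mul_left s step2).trans step1

/-- If the `n!`-conjecture holds for the partition `ν = (r-1, r^{s-1})` (the
rectangle `r^s` with its unique corner cell removed), then it holds for the
rectangular partition `μ = r^s` of `n+1 = r·s`. -/
theorem statement0 (r s : ℕ) (hr : 2 ≤ r) (hs : 1 ≤ s)
    (eμ : Fin (r * s) ≃ {c // c ∈ Finset.range s ×ˢ Finset.range r})
    (eν : Fin (r * s - 1) ≃
      {c // c ∈ (Finset.range s ×ˢ Finset.range r).erase (s - 1, r - 1)})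
    (hν : Module.finrank ℚ ↥(GHmodule (r * s - 1)
        ((Finset.range s ×ˢ Finset.range r).erase (s - 1, r - 1)) eν) =
      Nat.factorial (r * s - 1)) :
    Module.finrank ℚ ↥(GHmodule (r * s) (Finset.range s ×ˢ Finset.range r) eμ) =
      Nat.factorial (r * s) := by
  classical
  have hrs : 1 ≤ r * s := Nat.mul_pos (by omega) hs
  obtain ⟨n, hn⟩ : ∃ n, r * s = n + 1 := ⟨r * s - 1, by omega⟩
  have hn' : s * r = n + 1 := by rw [mul_comm]; exact hn
  revert eμ eν hν
  rw [hn]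
  intro eμ eν hν
  obtain ⟨hfin, hup⟩ := gh_upper (n+1) r s eμ
  have hlow := gh_lower n r s (by omega) hs eμ eν hfin
  have hν' : Module.finrank ℚ ↥(GHmodule n
        ((Finset.range s ×ˢ Finset.range r).erase (s - 1, r - 1)) eν) = n.factorial := hν
  rw [hν', ← mul_assoc, hn'] at hlow
  exact le_antisymm hup (by rw [Nat.factorial_succ]; exact hlow)
end

section
/- Let r ≥ 2 and s ≥ 1, let μ be the rectangular partition of rs consisting of s parts equal to r, and let ν be the partition of rs−1 consisting of s−1 parts equal to r and one part equal to r−1. If dim_ℚ M_ν = (rs−1)!, then the bigraded Hilbert series satisfy G_μ(q,t) = B_μ(q,t)·G_ν(q,t), where B_μ(q,t) = (1+t+⋯+t^{s−1})(1+q+⋯+q^{r−1}). -/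
open MvPolynomial




/-- Total degree in the `x`-variables of a monomial exponent vector. -/
def xdeg (n : ℕ) (d : (Fin n ⊕ Fin n) →₀ ℕ) : ℕ := ∑ i : Fin n, d (Sum.inl i)

/-- Total degree in the `y`-variables of a monomial exponent vector. -/
def ydeg (n : ℕ) (d : (Fin n ⊕ Fin n) →₀ ℕ) : ℕ := ∑ i : Fin n, d (Sum.inr i)

/-- The bihomogeneous component `H_{h,k}(W)`: elements of `W` which are
bihomogeneous of degree `h` in the `x`-variables and `k` in the `y`-variables
(indexed by integers; for negative `h` or `k` only `0` qualifies). -/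
def biComponent (n : ℕ) (h k : ℤ) (W : Set (MvPolynomial (Fin n ⊕ Fin n) ℚ)) :
    Set (MvPolynomial (Fin n ⊕ Fin n) ℚ) :=
  {P ∈ W | ∀ d, coeff d P ≠ 0 → (xdeg n d : ℤ) = h ∧ (ydeg n d : ℤ) = k}


/-- Exponent configurations: one exponent pair for each index. -/
abbrev UU (n : ℕ) := Fin n → ℕ × ℕ

/-- bidegree -/
def bideg {n : ℕ} (u : UU n) : ℤ × ℤ := (∑ r, ((u r).1 : ℤ), ∑ r, ((u r).2 : ℤ))

lemma bideg_add {n : ℕ} (u v : UU n) : bideg (u + v) = bideg u + bideg v := by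
  simp [bideg, Finset.sum_add_distrib]

/-- functions supported in bidegree p -/
def Bsub (n : ℕ) (p : ℤ × ℤ) : Submodule ℚ (UU n → ℚ) where
  carrier := {f | ∀ u, f u ≠ 0 → bideg u = p}
  zero_mem' := by intro u h; simp at h
  add_mem' := by
    intro f g hf hg u h
    by_cases h1 : f u = 0
    · apply hg; intro h2; simp [h1, h2] at h
    · exact hf u h1
  smul_mem' := by
    intro c f hf u h
    apply hf; intro h2; simp [h2] at h

/-- span of the shifts of a function -/
def Ns {n : ℕ} (F : UU n → ℚ) : Submodule ℚ (UU n → ℚ) :=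
  Submodule.span ℚ (Set.range fun v : UU n => fun u => F (u + v))

/-- the sign function of an enumeration of cells -/
noncomputable def AA {n : ℕ} (c : Fin n → ℕ × ℕ) (u : UU n) : ℚ :=
  Matrix.det (Matrix.of fun r j : Fin n => if u r = c j then (1 : ℚ) else 0)

/-- projection to bidegree -/
def prj (n : ℕ) (p : ℤ × ℤ) : (UU n → ℚ) →ₗ[ℚ] (UU n → ℚ) where
  toFun f u := if bideg u = p then f u else 0
  map_add' f g := by ext u; by_cases h : bideg u = p <;> simp [h]
  map_smul' c f := by ext u; by_cases h : bideg u = p <;> simp [h]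

lemma prj_apply (n : ℕ) (p : ℤ × ℤ) (f : UU n → ℚ) (u : UU n) :
    prj n p f u = if bideg u = p then f u else 0 := rfl

lemma prj_mem_Bsub (n : ℕ) (p : ℤ × ℤ) (f : UU n → ℚ) : prj n p f ∈ Bsub n p := by
  intro u h
  by_contra h2
  simp [prj_apply, h2] at h

/-- triangularity lemma -/
lemma tri {ι : Type*} [Fintype ι] [DecidableEq ι] {X Y : Type*} [AddCommGroup X] [Module ℚ X]
    [AddCommGroup Y] [Module ℚ Y] (W : Submodule ℚ X) [Module.Finite ℚ W]
    (H : ι → Submodule ℚ Y) (coef : ι → X →ₗ[ℚ] Y) (ρ : ι → ℤ)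
    (hl : ∀ i, ∀ b ∈ H i, ∃ w ∈ W, coef i w = b ∧ ∀ j, j ≠ i → ρ i ≤ ρ j → coef j w = 0) :
    (∀ i, Module.Finite ℚ (H i)) ∧ ∑ i, Module.finrank ℚ (H i) ≤ Module.finrank ℚ W := by
  classical
  -- linear lifts
  have lift : ∀ i, ∃ g : H i →ₗ[ℚ] W, ∀ b, coef i (g b : X) = b ∧
      ∀ j, j ≠ i → ρ i ≤ ρ j → coef j (g b : X) = 0 := by
    intro i
    let S : Submodule ℚ X :=
      W ⊓ (⨅ j : {j // j ≠ i ∧ ρ i ≤ ρ j}, LinearMap.ker (coef j.1)) ⊓ (H i).comap (coef i)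
    let f : S →ₗ[ℚ] H i := ((coef i).comp S.subtype).codRestrict (H i) (fun x => x.2.2)
    have hf : Function.Surjective f := by
      rintro ⟨b, hb⟩
      obtain ⟨w, hw, h1, h2⟩ := hl i b hb
      refine ⟨⟨w, ⟨⟨hw, ?_⟩, ?_⟩⟩, ?_⟩
      · simp only [SetLike.mem_coe, Submodule.mem_iInf, LinearMap.mem_ker]
        rintro ⟨j, hj⟩
        exact h2 j hj.1 hj.2
      · show coef i w ∈ H i
        rw [h1]; exact hb
      · apply Subtype.ext; exact h1
    obtain ⟨g, hg⟩ := f.exists_rightInverse_of_surjective (LinearMap.range_eq_top.2 hf)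
    refine ⟨(Submodule.inclusion (fun x hx => hx.1.1 : S ≤ W)).comp g, fun b => ⟨?_, ?_⟩⟩
    · have := LinearMap.congr_fun hg b
      exact congrArg Subtype.val this
    · intro j hj hij
      have := (g b).2.1.2
      simp only [SetLike.mem_coe, Submodule.mem_iInf, LinearMap.mem_ker] at this
      exact this ⟨j, hj, hij⟩
  choose g hg1 using lift
  let T : (∀ i, H i) →ₗ[ℚ] W := ∑ i, (g i).comp (LinearMap.proj i)
  have hT : Function.Injective T := by
    rw [← LinearMap.ker_eq_bot, LinearMap.ker_eq_bot']
    intro b hb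
    by_contra hne
    have : (Finset.univ.filter fun i => b i ≠ 0).Nonempty := by
      by_contra hem
      apply hne
      funext i
      by_contra hi
      apply hem
      exact ⟨i, by simpa using hi⟩
    obtain ⟨i, hi, hmax⟩ := Finset.exists_max_image _ ρ this
    simp only [Finset.mem_filter, Finset.mem_univ, true_and] at hi hmax
    have h0 : coef i ((T b : W) : X) = 0 := by rw [hb]; simp
    simp only [T, LinearMap.sum_apply, LinearMap.comp_apply, LinearMap.proj_apply,
      Submodule.coe_sum, map_sum] at h0
    rw [Finset.sum_eq_single i] at h0
    · rw [(hg1 i (b i)).1] at h0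
      apply hi; exact Subtype.ext h0
    · intro j _ hji
      by_cases hbj : b j = 0
      · simp [hbj]
      · exact (hg1 j (b j)).2 i hji.symm (hmax j hbj)
    · simp
  have hfin : Module.Finite ℚ (∀ i, H i) := Module.Finite.of_injective T hT
  have hfi : ∀ i, Module.Finite ℚ (H i) := fun i =>
    Module.Finite.of_injective (LinearMap.single ℚ (fun i => H i) i)
      (fun a b h => Pi.single_injective (M := fun i => H i) i h)
  refine ⟨hfi, ?_⟩
  rw [← Module.finrank_pi_fintype ℚ]
  exact LinearMap.finrank_le_finrank_of_injective hT

lemma Ns_induction {n : ℕ} {F : UU n → ℚ} {P : (UU n → ℚ) → Prop}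
    (hg : ∀ v, P (fun u => F (u + v))) (h0 : P 0) (ha : ∀ f g, P f → P g → P (f + g))
    (hs : ∀ (c : ℚ) f, P f → P (c • f)) : ∀ f ∈ Ns F, P f := by
  intro f hf
  induction hf using Submodule.span_induction with
  | mem x h => obtain ⟨v, rfl⟩ := h; exact hg v
  | zero => exact h0
  | add x y _ _ hx hy => exact ha x y hx hy
  | smul c x _ hx => exact hs c x hx

lemma Ns_gen {n : ℕ} (F : UU n → ℚ) (v : UU n) : (fun u => F (u + v)) ∈ Ns F :=
  Submodule.subset_span ⟨v, rfl⟩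

/-- gradedness -/
lemma prj_Ns {n : ℕ} {F : UU n → ℚ} {D : ℤ × ℤ} (hF : F ∈ Bsub n D) (p : ℤ × ℤ) :
    ∀ f ∈ Ns F, prj n p f ∈ Ns F := by
  apply Ns_induction
  · intro v
    by_cases hv : bideg v + p = D
    · convert Ns_gen F v using 1
      funext u
      rw [prj_apply]
      split_ifs with h
      · rfl
      · by_contra h2
        have := hF _ (Ne.symm h2)
        rw [bideg_add] at this
        apply h
        rw [← hv, add_comm] at this
        exact add_left_cancel this
    · convert (Ns F).zero_mem
      funext u
      rw [prj_apply]
      split_ifs with h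
      · by_contra h2
        have := hF _ h2
        rw [bideg_add, h, add_comm] at this
        exact hv this
      · rfl
  · simp
  · intro f g hf hg; rw [map_add]; exact add_mem hf hg
  · intro c f hf; rw [map_smul]; exact Submodule.smul_mem _ _ hf

lemma Ns_le_iSup {n : ℕ} {F : UU n → ℚ} {D : ℤ × ℤ} (hF : F ∈ Bsub n D) :
    Ns F ≤ ⨆ p, Ns F ⊓ Bsub n p := by
  intro f hf
  refine Ns_induction (P := fun f => f ∈ ⨆ p, Ns F ⊓ Bsub n p) ?_ ?_ ?_ ?_ f hf
  · intro v
    refine Submodule.mem_iSup_of_mem (D - bideg v) ⟨Ns_gen F v, ?_⟩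
    intro u h
    have := hF _ h
    rw [bideg_add] at this
    rw [← this]; simp
  · exact zero_mem _
  · intro f g; exact add_mem
  · intro c f; exact Submodule.smul_mem _ _

lemma finrank_finset_sup_le {V ι : Type*} [AddCommGroup V] [Module ℚ V] (H : ι → Submodule ℚ V)
    [∀ i, Module.Finite ℚ (H i)] (S : Finset ι) :
    Module.finrank ℚ (S.sup H : Submodule ℚ V) ≤ ∑ i ∈ S, Module.finrank ℚ (H i) := by
  classical
  induction S using Finset.induction_on with
  | empty => simp
  | insert a S ha ih =>
    rw [Finset.sup_insert, Finset.sum_insert ha]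
    exact (Submodule.finrank_add_le_finrank_add_finrank _ _).trans (by gcongr)

/-- Part 3 -/
lemma exists_S0 {n : ℕ} {F : UU n → ℚ} {D : ℤ × ℤ} (hF : F ∈ Bsub n D)
    [Module.Finite ℚ (Ns F)] :
    ∃ S : Finset (ℤ × ℤ), Module.finrank ℚ (Ns F) ≤
      ∑ p ∈ S, Module.finrank ℚ (Ns F ⊓ Bsub n p : Submodule ℚ _) := by
  have hc : IsCompactElement (Ns F) :=
    (Submodule.fg_iff_compact _).1 (Module.Finite.iff_fg.1 inferInstance)
  obtain ⟨S, hS⟩ := CompleteLattice.IsCompactElement.exists_finset_of_le_iSup _ hc _ (Ns_le_iSup hF)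
  have hfi : ∀ p, Module.Finite ℚ (Ns F ⊓ Bsub n p : Submodule ℚ _) := fun p =>
    Submodule.finiteDimensional_of_le inf_le_left
  refine ⟨S, le_trans ?_ (finrank_finset_sup_le (fun p => Ns F ⊓ Bsub n p) S)⟩
  apply Submodule.finrank_mono
  rw [Finset.sup_eq_iSup]
  exact hS

/-- total degree -/
def tdeg {n : ℕ} (u : UU n) : ℤ := (bideg u).1 + (bideg u).2

lemma tdeg_add {n : ℕ} (u v : UU n) : tdeg (u + v) = tdeg u + tdeg v := by
  simp only [tdeg, bideg_add, Prod.fst_add, Prod.snd_add]; ring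

lemma tdeg_eq {n : ℕ} (u : UU n) : tdeg u = ∑ r, (((u r).1 : ℤ) + (u r).2) := by
  simp [tdeg, bideg, Finset.sum_add_distrib]

lemma AA_mem {n : ℕ} (c : Fin n → ℕ × ℕ) : AA c ∈ Bsub n (bideg c) := by
  intro u hu
  have : ∃ σ : Equiv.Perm (Fin n), ∀ j, u (σ j) = c j := by
    by_contra hne
    push Not at hne
    apply hu
    rw [AA, Matrix.det_apply']
    apply Finset.sum_eq_zero
    intro σ _
    obtain ⟨j, hj⟩ := hne σ
    rw [Finset.prod_eq_zero (Finset.mem_univ j)]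
    · simp
    · simp [hj]
  obtain ⟨σ, hσ⟩ := this
  have h : c = u ∘ σ := by funext j; simp [hσ]
  rw [h]
  simp only [bideg, Function.comp]
  rw [Equiv.sum_comp σ (fun r => ((u r).1 : ℤ)), Equiv.sum_comp σ (fun r => ((u r).2 : ℤ))]

lemma detT {n : ℕ} (c : Fin n → ℕ × ℕ) (T : ℕ × ℕ → Fin n → ℚ)
    (hT : ∀ p k, T p k ≠ 0 → p = c k ∨ (c k).1 + (c k).2 < p.1 + p.2)
    (hT1 : ∀ k, T (c k) k = 1) (u : UU n) (hu : tdeg u ≤ tdeg c) :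
    Matrix.det (Matrix.of fun r k : Fin n => T (u r) k) = AA c u := by
  rw [AA, Matrix.det_apply', Matrix.det_apply']
  apply Finset.sum_congr rfl
  intro σ _
  congr 1
  simp only [Matrix.of_apply]
  by_cases h : ∀ j, u (σ j) = c j
  · simp [h, hT1]
  · push Not at h
    obtain ⟨j, hj⟩ := h
    rw [Finset.prod_eq_zero (i := j) (f := fun x => if u (σ x) = c x then (1:ℚ) else 0)
      (Finset.mem_univ j) (by simp [hj])]
    by_contra hne
    have hall : ∀ k, T (u (σ k)) k ≠ 0 := by
      intro k hk
      exact hne (Finset.prod_eq_zero (Finset.mem_univ k) hk)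
    have : ∑ k, (((c k).1 : ℤ) + (c k).2) < ∑ k, (((u (σ k)).1 : ℤ) + (u (σ k)).2) := by
      apply Finset.sum_lt_sum
      · intro k _
        rcases hT _ _ (hall k) with h | h
        · rw [h]
        · exact_mod_cast h.le
      · refine ⟨j, Finset.mem_univ j, ?_⟩
        rcases hT _ _ (hall j) with h | h
        · exact absurd h hj
        · exact_mod_cast h
    rw [Equiv.sum_comp σ (fun r => ((u r).1 : ℤ) + (u r).2), ← tdeg_eq, ← tdeg_eq] at this
    omega

/-- Part 1: upper bound. -/
lemma upper {n : ℕ} (c : Fin n → ℕ × ℕ) (T : ℕ × ℕ → Fin n → ℚ) (w : Fin n → ℚ × ℚ)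
    (hT : ∀ p k, T p k ≠ 0 → p = c k ∨ (c k).1 + (c k).2 < p.1 + p.2)
    (hT1 : ∀ k, T (c k) k = 1)
    (hm : ∀ (p : ℕ × ℕ) j, (w j).1 ^ p.1 * (w j).2 ^ p.2 =
      ∑ k, T p k * ((w j).1 ^ (c k).1 * (w j).2 ^ (c k).2))
    (hκ : Matrix.det (Matrix.of fun k j : Fin n => (w j).1 ^ (c k).1 * (w j).2 ^ (c k).2) ≠ 0)
    (S : Finset (ℤ × ℤ)) :
    (∀ p ∈ S, Module.Finite ℚ (Ns (AA c) ⊓ Bsub n p : Submodule ℚ _)) ∧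
    ∑ p ∈ S, Module.finrank ℚ (Ns (AA c) ⊓ Bsub n p : Submodule ℚ _) ≤ n.factorial := by
  classical
  set κ := Matrix.det (Matrix.of fun k j : Fin n => (w j).1 ^ (c k).1 * (w j).2 ^ (c k).2) with hκd
  let E : UU n → ℚ := fun u =>
    Matrix.det (Matrix.of fun r j : Fin n => (w j).1 ^ (u r).1 * (w j).2 ^ (u r).2)
  let χ : Equiv.Perm (Fin n) → UU n → ℚ := fun σ u =>
    ∏ j, ((w j).1 ^ (u (σ j)).1 * (w j).2 ^ (u (σ j)).2)
  let K : Submodule ℚ (UU n → ℚ) := Submodule.span ℚ (Set.range χ)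
  have hK : Module.finrank ℚ K ≤ n.factorial := by
    have := finrank_range_le_card (R := ℚ) χ
    rw [Fintype.card_perm, Fintype.card_fin] at this
    exact this
  have hKf : Module.Finite ℚ K := Module.Finite.span_of_finite ℚ (Set.finite_range χ)
  have hEK : ∀ v, (fun u => E (u + v)) ∈ K := by
    intro v
    have : (fun u => E (u + v)) =
        ∑ σ : Equiv.Perm (Fin n), (((Equiv.Perm.sign σ : ℤ) : ℚ) * χ σ v) • χ σ := by
      funext u
      simp only [E, Matrix.det_apply', Finset.sum_apply, Pi.smul_apply, smul_eq_mul]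
      apply Finset.sum_congr rfl
      intro σ _
      rw [mul_assoc]
      congr 1
      simp only [χ, ← Finset.prod_mul_distrib, Matrix.of_apply]
      apply Finset.prod_congr rfl
      intro j _
      simp only [Pi.add_apply, Prod.fst_add, Prod.snd_add, pow_add]
      ring
    rw [this]
    exact Submodule.sum_mem _ fun σ _ => Submodule.smul_mem _ _ (Submodule.subset_span ⟨σ, rfl⟩)
  have hE : ∀ u, tdeg u ≤ tdeg c → E u = AA c u * κ := by
    intro u hu
    rw [← detT c T hT hT1 u hu, hκd, ← Matrix.det_mul]
    simp only [E]
    congr 1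
    ext r j
    simp only [Matrix.of_apply, Matrix.mul_apply]
    exact hm (u r) j
  have hAA : ∀ u, AA c u ≠ 0 → tdeg u = tdeg c := by
    intro u hu
    simp only [tdeg]
    rw [AA_mem c u hu]
  have hlift : ∀ δ : ℤ, ∀ f ∈ Ns (AA c), ∃ g ∈ K, ∀ u, tdeg u ≤ δ →
      g u = if tdeg u = δ then κ * f u else 0 := by
    intro δ
    apply Ns_induction
    · intro v
      by_cases hv : δ + tdeg v = tdeg c
      · refine ⟨_, hEK v, fun u hu => ?_⟩
        rw [hE _ (by rw [tdeg_add]; omega)]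
        split_ifs with h
        · ring
        · have : AA c (u + v) = 0 := by
            by_contra h2
            have := hAA _ h2
            rw [tdeg_add] at this
            omega
          rw [this, zero_mul]
      · refine ⟨0, zero_mem _, fun u hu => ?_⟩
        split_ifs with h
        · have : AA c (u + v) = 0 := by
            by_contra h2
            have := hAA _ h2
            rw [tdeg_add] at this
            omega
          show (0 : ℚ) = κ * AA c (u + v)
          rw [this, mul_zero]
        · rfl
    · exact ⟨0, zero_mem _, fun u hu => by simp⟩
    · rintro f g ⟨f', hf, hf'⟩ ⟨g', hg, hg'⟩
      refine ⟨f' + g', add_mem hf hg, fun u hu => ?_⟩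
      rw [Pi.add_apply, hf' u hu, hg' u hu]
      split_ifs
      · simp [mul_add]
      · simp
    · rintro a f ⟨f', hf, hf'⟩
      refine ⟨a • f', Submodule.smul_mem _ _ hf, fun u hu => ?_⟩
      rw [Pi.smul_apply, hf' u hu]
      split_ifs
      · simp; ring
      · simp
  have key := tri (ι := S) K (fun p => Ns (AA c) ⊓ Bsub n p.1)
    (fun p => κ⁻¹ • prj n p.1) (fun p => -(p.1.1 + p.1.2)) (by
      rintro ⟨p, hp⟩ b ⟨hb, hbp⟩
      obtain ⟨g, hg, hg'⟩ := hlift (p.1 + p.2) b hb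
      refine ⟨g, hg, ?_, ?_⟩
      · funext u
        simp only [LinearMap.smul_apply, Pi.smul_apply, smul_eq_mul, prj_apply]
        split_ifs with h
        · have ht : tdeg u = p.1 + p.2 := by simp [tdeg, h]
          rw [hg' u ht.le, if_pos ht, inv_mul_cancel_left₀ hκ]
        · by_contra h2
          apply h; apply hbp; intro h3; simp [h3] at h2
      · rintro ⟨q, hq⟩ hne hle
        funext u
        simp only [LinearMap.smul_apply, Pi.smul_apply, smul_eq_mul, prj_apply]
        split_ifs with h
        · have ht : tdeg u = q.1 + q.2 := by simp [tdeg, h]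
          simp only at hle
          rw [hg' u (by omega)]
          split_ifs with h3
          · have : b u = 0 := by
              by_contra h4
              apply hne
              apply Subtype.ext
              show q = p
              rw [← h, hbp u h4]
            simp [this]
          · simp
        · simp)
  refine ⟨fun p hp => key.1 ⟨p, hp⟩, ?_⟩
  rw [← Finset.sum_coe_sort]
  exact key.2.trans hK

lemma cons_add {m : ℕ} (x y : ℕ × ℕ) (u v : UU m) :
    ((Fin.cons x u : UU (m+1)) + (Fin.cons y v : UU (m+1))) = (Fin.cons (x + y) (u + v) : UU (m+1)) := by
  funext i
  refine Fin.cases ?_ (fun i => ?_) i <;> simp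

lemma bideg_cons {m : ℕ} (x : ℕ × ℕ) (u : UU m) :
    bideg (Fin.cons x u : UU (m+1)) = ((x.1 : ℤ), (x.2 : ℤ)) + bideg u := by
  simp [bideg, Fin.sum_univ_succ]

/-- extraction of a coefficient in variable zero -/
def cf (m : ℕ) (x : ℕ × ℕ) : (UU (m+1) → ℚ) →ₗ[ℚ] (UU m → ℚ) where
  toFun f u := f (Fin.cons x u)
  map_add' f g := rfl
  map_smul' c f := rfl

/-- Part 2: lower bound -/
lemma lower {m : ℕ} (c : Fin (m+1) → ℕ × ℕ) (c' : Fin m → ℕ × ℕ) (R : Finset (ℕ × ℕ))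
    (t : ℕ × ℕ) (θ : ℚ) (hθ : θ ≠ 0) (hc : ∀ k, c k ≤ t) (hR : ∀ x ∈ R, x ≤ t)
    (hcc : ∀ u, AA c (Fin.cons t u : UU (m+1)) = θ * AA c' u) (p : ℤ × ℤ)
    [Module.Finite ℚ (Ns (AA c) ⊓ Bsub (m+1) p : Submodule ℚ _)] :
    ∑ x ∈ R, Module.finrank ℚ (Ns (AA c') ⊓ Bsub m (p - ((x.1 : ℤ), (x.2 : ℤ))) : Submodule ℚ _) ≤
      Module.finrank ℚ (Ns (AA c) ⊓ Bsub (m+1) p : Submodule ℚ _) := by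
  classical
  have h0 : ∀ x u, ¬ x ≤ t → AA c (Fin.cons x u : UU (m+1)) = 0 := by
    intro x u hx
    rw [AA]
    apply Matrix.det_eq_zero_of_row_eq_zero 0
    intro j
    simp only [Matrix.of_apply, Fin.cons_zero]
    rw [if_neg]
    rintro rfl
    exact hx (hc j)
  have hlift : ∀ x, x ≤ t → ∀ b ∈ Ns (AA c'), ∃ w ∈ Ns (AA c), ∀ u,
      w (Fin.cons x u : UU (m+1)) = θ * b u ∧
      ∀ y, ¬ y ≤ x → w (Fin.cons y u : UU (m+1)) = 0 := by
    intro x hx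
    apply Ns_induction
    · intro v
      refine ⟨_, Ns_gen _ (Fin.cons (t - x) v : UU (m+1)), fun u => ⟨?_, fun y hy => ?_⟩⟩
      · simp only [cons_add]
        rw [add_tsub_cancel_of_le hx, hcc]
      · simp only [cons_add]
        apply h0
        intro h
        apply hy
        rw [Prod.le_def] at *
        simp at h hx ⊢
        omega
    · exact ⟨0, zero_mem _, fun u => by simp⟩
    · rintro f g ⟨f', hf, hf'⟩ ⟨g', hg, hg'⟩
      refine ⟨f' + g', add_mem hf hg, fun u => ⟨?_, fun y hy => ?_⟩⟩
      · simp [(hf' u).1, (hg' u).1, mul_add]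
      · simp [(hf' u).2 y hy, (hg' u).2 y hy]
    · rintro a f ⟨f', hf, hf'⟩
      refine ⟨a • f', Submodule.smul_mem _ _ hf, fun u => ⟨?_, fun y hy => ?_⟩⟩
      · simp [(hf' u).1]; ring
      · simp [(hf' u).2 y hy]
  have key := tri (ι := R) (Ns (AA c) ⊓ Bsub (m+1) p)
    (fun x => Ns (AA c') ⊓ Bsub m (p - ((x.1.1 : ℤ), (x.1.2 : ℤ))))
    (fun x => θ⁻¹ • cf m x.1) (fun x => x.1.1 + x.1.2) (by
      rintro ⟨x, hx⟩ b ⟨hb, hbp⟩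
      obtain ⟨w, hw, hw'⟩ := hlift x (hR x hx) b hb
      refine ⟨prj (m+1) p w, ⟨prj_Ns (AA_mem c) p w hw, prj_mem_Bsub _ _ _⟩, ?_, ?_⟩
      · funext u
        show θ⁻¹ * (prj (m+1) p w (Fin.cons x u)) = b u
        rw [prj_apply]
        split_ifs with h
        · rw [(hw' u).1, inv_mul_cancel_left₀ hθ]
        · by_contra h2
          apply h
          rw [bideg_cons, hbp u (by intro h3; simp [h3] at h2)]
          simp
      · rintro ⟨y, hy⟩ hne hle
        funext u
        show θ⁻¹ * (prj (m+1) p w (Fin.cons y u)) = 0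
        rw [prj_apply]
        split_ifs with h
        · rw [(hw' u).2, mul_zero]
          intro hyx
          apply hne
          apply Subtype.ext
          rw [Prod.le_def] at hyx
          show y = x
          simp only at hle
          ext <;> omega
        · simp)
  rw [← Finset.sum_coe_sort]
  exact key.2

lemma exists_theta {m : ℕ} (c : Fin (m+1) → ℕ × ℕ) (c' : Fin m → ℕ × ℕ) (t : ℕ × ℕ)
    (hc : Function.Injective c) (hc' : Function.Injective c')
    (ht : ∃ k, c k = t) (h : ∀ j, c' j ≠ t ∧ ∃ k, c k = c' j) :
    ∃ θ : ℚ, θ ≠ 0 ∧ ∀ u, AA c (Fin.cons t u : UU (m+1)) = θ * AA c' u := by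
  obtain ⟨k0, hk0⟩ := ht
  have h1 : ∀ j, ∃ i, c (k0.succAbove i) = c' j := by
    intro j
    obtain ⟨hne, k, hk⟩ := h j
    have : k ≠ k0 := by rintro rfl; exact hne (hk.symm.trans hk0)
    obtain ⟨i, hi⟩ := Fin.exists_succAbove_eq this
    exact ⟨i, by rw [hi, hk]⟩
  choose τ hτ using h1
  have hτi : Function.Injective τ := by
    intro a b hab
    apply hc'
    rw [← hτ, ← hτ, hab]
  let σ : Equiv.Perm (Fin m) := Equiv.ofBijective τ (Finite.injective_iff_bijective.1 hτi)
  have hσ : ∀ j, c (k0.succAbove (σ j)) = c' j := hτ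
  have hA : ∀ u, AA c' u = ((Equiv.Perm.sign σ : ℤ) : ℚ) *
      Matrix.det (Matrix.of fun r j : Fin m => if u r = c (k0.succAbove j) then (1:ℚ) else 0) := by
    intro u
    rw [← Matrix.det_permute', AA]
    congr 1
    ext r j
    simp [hσ]
  have hs : ((Equiv.Perm.sign σ : ℤ) : ℚ) * ((Equiv.Perm.sign σ : ℤ) : ℚ) = 1 := by
    rw [← Int.cast_mul, ← Units.val_mul, Int.units_mul_self]; simp
  refine ⟨(-1) ^ (k0 : ℕ) * ((Equiv.Perm.sign σ : ℤ) : ℚ), ?_, fun u => ?_⟩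
  · apply mul_ne_zero (by simp)
    intro h0; rw [h0] at hs; simp at hs
  · rw [hA, mul_assoc, ← mul_assoc ((Equiv.Perm.sign σ : ℤ) : ℚ), hs, one_mul, AA,
      Matrix.det_succ_row_zero, Finset.sum_eq_single k0]
    · simp only [Matrix.of_apply, Fin.cons_zero, hk0, if_true, mul_one]
      congr 1
    · intro b _ hb
      have : t ≠ c b := by rintro h; exact hb (hc (h.symm.trans hk0.symm))
      simp [this]
    · simp

/-- node polynomial -/
noncomputable def nodeP (s : ℕ) : Polynomial ℚ :=
  ∏ a ∈ Finset.range s, (Polynomial.X - Polynomial.C (a : ℚ))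

lemma nodeP_monic (s : ℕ) : (nodeP s).Monic :=
  Polynomial.monic_prod_of_monic _ _ fun a _ => Polynomial.monic_X_sub_C _

lemma nodeP_natDegree (s : ℕ) : (nodeP s).natDegree = s := by
  rw [nodeP, Polynomial.natDegree_prod_of_monic _ _ fun a _ => Polynomial.monic_X_sub_C _]
  simp only [Polynomial.natDegree_X_sub_C, Finset.sum_const, Finset.card_range, smul_eq_mul, mul_one]

/-- reduction coefficients -/
noncomputable def redC (s p i : ℕ) : ℚ := ((Polynomial.X ^ p : Polynomial ℚ) %ₘ nodeP s).coeff i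

lemma redC_self (s p i : ℕ) (hp : p < s) : redC s p i = if i = p then 1 else 0 := by
  rw [redC, (Polynomial.modByMonic_eq_self_iff (nodeP_monic s)).2, Polynomial.coeff_X_pow]
  rw [Polynomial.degree_X_pow, Polynomial.degree_eq_natDegree (nodeP_monic s).ne_zero,
    nodeP_natDegree]
  exact_mod_cast hp

lemma redC_sum (s p a : ℕ) (ha : a < s) :
    (a : ℚ) ^ p = ∑ i ∈ Finset.range s, redC s p i * (a : ℚ) ^ i := by
  have hroot : (nodeP s).IsRoot (a : ℚ) := by
    rw [Polynomial.IsRoot, nodeP, Polynomial.eval_prod]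
    exact Finset.prod_eq_zero (Finset.mem_range.2 ha) (by simp)
  have h1 : ((Polynomial.X ^ p : Polynomial ℚ) %ₘ nodeP s).eval (a : ℚ) = (a : ℚ) ^ p := by
    have := congrArg (Polynomial.eval (a : ℚ))
      (Polynomial.modByMonic_add_div (Polynomial.X ^ p : Polynomial ℚ) (nodeP s))
    rw [Polynomial.eval_add, Polynomial.eval_mul, hroot.eq_zero, zero_mul, add_zero] at this
    simpa using this
  rw [← h1]
  apply Polynomial.eval_eq_sum_range'
  have := Polynomial.natDegree_modByMonic_lt (Polynomial.X ^ p : Polynomial ℚ) (nodeP_monic s)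
    (by intro h; have := nodeP_natDegree s; rw [h] at this; simp at this; omega)
  rwa [nodeP_natDegree] at this

lemma redC_ne (s p i : ℕ) (hi : i < s) (h : redC s p i ≠ 0) : p = i ∨ i < p := by
  by_cases hp : p < s
  · rw [redC_self s p i hp] at h
    left; by_contra h2; apply h; rw [if_neg (Ne.symm h2)]
  · right; omega

/-- cells of rectangle -/
def rectEquiv (s r : ℕ) : {c // c ∈ Finset.range s ×ˢ Finset.range r} ≃ Fin s × Fin r where
  toFun c := (⟨c.1.1, Finset.mem_range.1 (Finset.mem_product.1 c.2).1⟩,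
    ⟨c.1.2, Finset.mem_range.1 (Finset.mem_product.1 c.2).2⟩)
  invFun x := ⟨(x.1, x.2), by simp⟩
  left_inv c := rfl
  right_inv x := rfl

lemma upper_rect {n r s : ℕ} (e : Fin n ≃ {c // c ∈ Finset.range s ×ˢ Finset.range r})
    (S : Finset (ℤ × ℤ)) :
    (∀ p ∈ S, Module.Finite ℚ (Ns (AA fun k => (e k).1) ⊓ Bsub n p : Submodule ℚ _)) ∧
    ∑ p ∈ S, Module.finrank ℚ (Ns (AA fun k => (e k).1) ⊓ Bsub n p : Submodule ℚ _) ≤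
      n.factorial := by
  have hlt : ∀ k, (e k).1.1 < s ∧ (e k).1.2 < r := by
    intro k; have := Finset.mem_product.1 (e k).2; simpa only [Finset.mem_range] using this
  apply upper (fun k => (e k).1) (fun p k => redC s p.1 (e k).1.1 * redC r p.2 (e k).1.2)
    (fun k => (((e k).1.1 : ℚ), ((e k).1.2 : ℚ)))
  · intro p k h
    have h1 := redC_ne _ _ _ (hlt k).1 (left_ne_zero_of_mul h)
    have h2 := redC_ne _ _ _ (hlt k).2 (right_ne_zero_of_mul h)
    by_cases hp : p = (e k).1
    · exact Or.inl hp
    · right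
      have : ¬ (p.1 = (e k).1.1 ∧ p.2 = (e k).1.2) := fun h => hp (Prod.ext h.1 h.2)
      omega
  · intro k
    rw [redC_self _ _ _ (hlt k).1, redC_self _ _ _ (hlt k).2]
    simp
  · intro p j
    rw [Equiv.sum_comp e (fun x => redC s p.1 x.1.1 * redC r p.2 x.1.2 *
      (((e j).1.1 : ℚ) ^ x.1.1 * ((e j).1.2 : ℚ) ^ x.1.2)),
      Finset.sum_coe_sort _ (fun x : ℕ × ℕ => redC s p.1 x.1 * redC r p.2 x.2 *
      (((e j).1.1 : ℚ) ^ x.1 * ((e j).1.2 : ℚ) ^ x.2)), Finset.sum_product]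
    simp only
    rw [redC_sum s p.1 _ (hlt j).1, redC_sum r p.2 _ (hlt j).2, Finset.sum_mul_sum]
    apply Finset.sum_congr rfl; intro a _
    apply Finset.sum_congr rfl; intro b _
    ring
  · have : (Matrix.of fun k j : Fin n => ((e j).1.1 : ℚ) ^ (e k).1.1 * ((e j).1.2 : ℚ) ^ (e k).1.2) =
        (Matrix.kroneckerMap (· * ·) (Matrix.vandermonde fun a : Fin s => ((a : ℕ) : ℚ)).transpose
          (Matrix.vandermonde fun a : Fin r => ((a : ℕ) : ℚ)).transpose).submatrix
          (e.trans (rectEquiv s r)) (e.trans (rectEquiv s r)) := by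
      ext k j
      simp [rectEquiv, Matrix.vandermonde_apply]
    simp only
    rw [this, Matrix.det_submatrix_equiv_self, Matrix.det_kronecker, Matrix.det_transpose,
      Matrix.det_transpose]
    apply mul_ne_zero <;> apply pow_ne_zero <;> rw [Matrix.det_vandermonde_ne_zero_iff] <;>
    · intro a b h
      simpa [Fin.ext_iff] using h

lemma main_fun {m r s : ℕ} (hr : 1 ≤ r) (hs : 1 ≤ s) (hm : r * s = m + 1)
    (e : Fin (m+1) ≃ {c // c ∈ Finset.range s ×ˢ Finset.range r})
    (e' : Fin m ≃ {c // c ∈ (Finset.range s ×ˢ Finset.range r).erase (s - 1, r - 1)})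
    (hν : Module.finrank ℚ (Ns (AA fun k => (e' k).1)) = m.factorial) (p : ℤ × ℤ) :
    Module.finrank ℚ (Ns (AA fun k => (e k).1) ⊓ Bsub (m+1) p : Submodule ℚ _) =
    ∑ x ∈ Finset.range s ×ˢ Finset.range r,
      Module.finrank ℚ (Ns (AA fun k => (e' k).1) ⊓ Bsub m (p - ((x.1 : ℤ), (x.2 : ℤ))) :
        Submodule ℚ _) := by
  classical
  have hf : Module.Finite ℚ (Ns (AA fun k => (e' k).1)) :=
    Module.finite_of_finrank_pos (by rw [hν]; exact Nat.factorial_pos m)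
  obtain ⟨θ, hθ, hcc⟩ := exists_theta (fun k => (e k).1) (fun k => (e' k).1) (s - 1, r - 1)
    (fun a b h => e.injective (Subtype.ext h)) (fun a b h => e'.injective (Subtype.ext h))
    ⟨e.symm ⟨(s-1, r-1), by simp; omega⟩, by simp⟩
    (fun j => ⟨Finset.ne_of_mem_erase (e' j).2,
      e.symm ⟨(e' j).1, Finset.mem_of_mem_erase (e' j).2⟩, by simp⟩)
  have hle : ∀ x ∈ Finset.range s ×ˢ Finset.range r, x ≤ (s-1, r-1) := by
    intro x hx
    simp only [Finset.mem_product, Finset.mem_range] at hx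
    rw [Prod.le_def]; simp only; omega
  have low : ∀ q, ∑ x ∈ Finset.range s ×ˢ Finset.range r,
      Module.finrank ℚ (Ns (AA fun k => (e' k).1) ⊓ Bsub m (q - ((x.1 : ℤ), (x.2 : ℤ))) :
        Submodule ℚ _) ≤
      Module.finrank ℚ (Ns (AA fun k => (e k).1) ⊓ Bsub (m+1) q : Submodule ℚ _) := by
    intro q
    have := (upper_rect e {q}).1 q (by simp)
    exact lower _ _ _ (s-1, r-1) θ hθ (fun k => hle _ (e k).2) hle hcc q
  obtain ⟨S0, hS0⟩ := exists_S0 (AA_mem fun k => (e' k).1)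
  let S : Finset (ℤ × ℤ) := insert p
    ((S0 ×ˢ (Finset.range s ×ˢ Finset.range r)).image fun z => z.1 + ((z.2.1 : ℤ), (z.2.2 : ℤ)))
  have hup := (upper_rect e S).2
  have hge : (m+1).factorial ≤ ∑ q ∈ S, ∑ x ∈ Finset.range s ×ˢ Finset.range r,
      Module.finrank ℚ (Ns (AA fun k => (e' k).1) ⊓ Bsub m (q - ((x.1 : ℤ), (x.2 : ℤ))) :
        Submodule ℚ _) := by
    rw [Finset.sum_comm]
    have : ∀ x ∈ Finset.range s ×ˢ Finset.range r, m.factorial ≤ ∑ q ∈ S,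
        Module.finrank ℚ (Ns (AA fun k => (e' k).1) ⊓ Bsub m (q - ((x.1 : ℤ), (x.2 : ℤ))) :
        Submodule ℚ _) := by
      intro x hx
      rw [← hν]
      refine hS0.trans ?_
      have hsub : S0.image (fun z => z + ((x.1 : ℤ), (x.2 : ℤ))) ⊆ S := by
        intro y hy
        simp only [Finset.mem_image] at hy
        obtain ⟨z, hz, rfl⟩ := hy
        apply Finset.mem_insert_of_mem
        simp only [Finset.mem_image]
        exact ⟨(z, x), Finset.mem_product.2 ⟨hz, hx⟩, rfl⟩
      refine le_trans (le_of_eq ?_) (Finset.sum_le_sum_of_subset hsub)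
      rw [Finset.sum_image (fun a _ b _ h => add_right_cancel h)]
      apply Finset.sum_congr rfl
      intro z _
      rw [add_sub_cancel_right]
    have h2 := Finset.sum_le_sum this
    rw [Finset.sum_const, Finset.card_product, Finset.card_range, Finset.card_range,
      mul_comm s r, hm, smul_eq_mul, ← Nat.factorial_succ] at h2
    exact h2
  have heq := (Finset.sum_eq_sum_iff_of_le (s := S) (fun q _ => low q)).1
    (le_antisymm (Finset.sum_le_sum fun q _ => low q) (hup.trans hge))
  exact (heq p (Finset.mem_insert_self _ _)).symm

/-- exponent vector as a Finsupp -/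
noncomputable def fu {n : ℕ} (u : UU n) : (Fin n ⊕ Fin n) →₀ ℕ :=
  Finsupp.equivFunOnFinite.symm (Sum.elim (fun r => (u r).1) (fun r => (u r).2))

@[simp] lemma fu_inl {n : ℕ} (u : UU n) (r : Fin n) : fu u (Sum.inl r) = (u r).1 := rfl
@[simp] lemma fu_inr {n : ℕ} (u : UU n) (r : Fin n) : fu u (Sum.inr r) = (u r).2 := rfl

lemma fu_surj {n : ℕ} (d : (Fin n ⊕ Fin n) →₀ ℕ) :
    fu (fun r => (d (Sum.inl r), d (Sum.inr r))) = d := by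
  ext x
  rcases x with x | x <;> rfl

lemma fu_inj {n : ℕ} {u v : UU n} (h : fu u = fu v) : u = v := by
  funext r
  have h1 := DFunLike.congr_fun h (Sum.inl r)
  have h2 := DFunLike.congr_fun h (Sum.inr r)
  exact Prod.ext h1 h2

/-- factorial weight -/
noncomputable def facD {n : ℕ} (d : (Fin n ⊕ Fin n) →₀ ℕ) : ℚ := ∏ x, ((d x).factorial : ℚ)

lemma facD_ne {n : ℕ} (d : (Fin n ⊕ Fin n) →₀ ℕ) : facD d ≠ 0 :=
  Finset.prod_ne_zero_iff.2 fun x _ => by exact_mod_cast Nat.factorial_ne_zero _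

lemma facD_add {n : ℕ} (d : (Fin n ⊕ Fin n) →₀ ℕ) (v : Fin n ⊕ Fin n) :
    facD (d + Finsupp.single v 1) = facD d * (d v + 1) := by
  classical
  rw [facD, facD, ← Finset.mul_prod_erase _ _ (Finset.mem_univ v),
    ← Finset.mul_prod_erase _ (fun x => ((d x).factorial : ℚ)) (Finset.mem_univ v)]
  have : ∏ x ∈ Finset.univ.erase v, (((d + Finsupp.single v 1 : (Fin n ⊕ Fin n) →₀ ℕ) x).factorial : ℚ) =
      ∏ x ∈ Finset.univ.erase v, ((d x).factorial : ℚ) := by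
    apply Finset.prod_congr rfl
    intro x hx
    have hx' : v ≠ x := (Finset.ne_of_mem_erase hx).symm
    simp [Finsupp.single_apply, hx']
  rw [this]
  simp only [Finsupp.add_apply, Finsupp.single_eq_same, Nat.factorial_succ]
  push_cast
  ring

/-- unit exponent -/
def ev {n : ℕ} (v : Fin n ⊕ Fin n) : UU n :=
  Sum.elim (fun i => Pi.single i (1, 0)) (fun i => Pi.single i (0, 1)) v

lemma fu_add_ev {n : ℕ} (u : UU n) (v : Fin n ⊕ Fin n) :
    fu (u + ev v) = fu u + Finsupp.single v 1 := by
  ext x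
  rcases v with v | v <;> rcases x with x | x <;>
    simp [ev, Finsupp.single_apply, Pi.single_apply] <;>
    by_cases h : x = v <;> simp [h] <;> intro h2 <;> exact absurd h2.symm h

/-- transform -/
noncomputable def Psi (n : ℕ) : MvPolynomial (Fin n ⊕ Fin n) ℚ →ₗ[ℚ] (UU n → ℚ) where
  toFun P u := facD (fu u) * coeff (fu u) P
  map_add' P Q := by funext u; simp [mul_add]
  map_smul' c P := by funext u; simp; ring

lemma Psi_apply {n : ℕ} (P : MvPolynomial (Fin n ⊕ Fin n) ℚ) (u : UU n) :
    Psi n P u = facD (fu u) * coeff (fu u) P := rfl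

lemma Psi_inj (n : ℕ) : Function.Injective (Psi n) := by
  rw [← LinearMap.ker_eq_bot, LinearMap.ker_eq_bot']
  intro P hP
  ext d
  have := congrFun hP (fun r => (d (Sum.inl r), d (Sum.inr r)))
  rw [Psi_apply, fu_surj] at this
  simpa [facD_ne] using this

lemma Psi_pderiv {n : ℕ} (v : Fin n ⊕ Fin n) (P : MvPolynomial (Fin n ⊕ Fin n) ℚ) (u : UU n) :
    Psi n (pderiv v P) u = Psi n P (u + ev v) := by
  rw [Psi_apply, Psi_apply, coeff_pderiv, fu_add_ev, facD_add]; ring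

lemma Psi_foldr {n : ℕ} (L : List (Fin n ⊕ Fin n)) (P : MvPolynomial (Fin n ⊕ Fin n) ℚ) :
    ∀ u : UU n, Psi n (L.foldr (fun v Q => pderiv v Q) P) u = Psi n P (u + (L.map ev).sum) := by
  induction L with
  | nil => intro u; simp
  | cons v L ih =>
    intro u
    rw [List.foldr_cons, Psi_pderiv, ih, List.map_cons, List.sum_cons, add_assoc]

lemma ev_sum {n : ℕ} (v : UU n) : ∃ L : List (Fin n ⊕ Fin n), (L.map ev).sum = v := by
  let S : AddSubmonoid (UU n) :=
    { carrier := {v | ∃ L : List (Fin n ⊕ Fin n), (L.map ev).sum = v}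
      zero_mem' := ⟨[], by simp⟩
      add_mem' := by
        rintro a b ⟨L, rfl⟩ ⟨L', rfl⟩
        exact ⟨L ++ L', by simp⟩ }
  have he : ∀ x, ev x ∈ S := fun x => ⟨[x], by simp⟩
  have : v = ∑ r, ((v r).1 • ev (Sum.inl r) + (v r).2 • ev (Sum.inr r)) := by
    funext i
    rw [Finset.sum_apply, Finset.sum_eq_single i]
    · ext <;> simp [ev]
    · intro b _ hb
      simp [ev, Pi.single_apply, hb.symm]
    · simp
  have hv : v ∈ S := by
    rw [this]
    exact sum_mem fun r _ => add_mem (nsmul_mem (he _) _) (nsmul_mem (he _) _)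
  exact hv

lemma map_derivSpan {n : ℕ} (P : MvPolynomial (Fin n ⊕ Fin n) ℚ) :
    (derivSpan n P).map (Psi n) = Ns (Psi n P) := by
  rw [derivSpan, Submodule.map_span, Ns]
  congr 1
  ext f
  constructor
  · rintro ⟨_, ⟨L, rfl⟩, rfl⟩
    exact ⟨(L.map ev).sum, by funext u; rw [Psi_foldr]⟩
  · rintro ⟨v, rfl⟩
    obtain ⟨L, rfl⟩ := ev_sum v
    exact ⟨_, ⟨L, rfl⟩, by funext u; rw [Psi_foldr]⟩

lemma prod_eq_monomial {n : ℕ} (w : UU n) :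
    ∏ r, ((X (Sum.inl r) : MvPolynomial (Fin n ⊕ Fin n) ℚ) ^ (w r).1 * X (Sum.inr r) ^ (w r).2) =
      monomial (fu w) 1 := by
  rw [monomial_eq, Finsupp.prod_fintype _ _ (by simp), Fintype.prod_sum_type,
    Finset.prod_mul_distrib]
  simp

lemma Psi_Delta {n : ℕ} (cells : Finset (ℕ × ℕ)) (e : Fin n ≃ {c // c ∈ cells}) :
    Psi n (Delta n cells e) = facD (fu fun k => (e k).1) • AA (fun k => (e k).1) := by
  classical
  funext u
  rw [Psi_apply, Delta, Pi.smul_apply, smul_eq_mul]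
  simp only [AA]
  rw [Matrix.det_apply', Matrix.det_apply', coeff_sum, Finset.mul_sum, Finset.mul_sum]
  apply Finset.sum_congr rfl
  intro σ _
  simp only [Matrix.of_apply]
  have h1 : ∏ i, ((X (Sum.inl (σ i)) : MvPolynomial (Fin n ⊕ Fin n) ℚ) ^ (e i).1.1 *
      X (Sum.inr (σ i)) ^ (e i).1.2) = monomial (fu fun r => (e (σ.symm r)).1) 1 := by
    rw [← prod_eq_monomial, ← Equiv.prod_comp σ (fun r =>
      (X (Sum.inl r) : MvPolynomial (Fin n ⊕ Fin n) ℚ) ^ (e (σ.symm r)).1.1 *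
      X (Sum.inr r) ^ (e (σ.symm r)).1.2)]
    simp only [Equiv.symm_apply_apply]
  have h2 : (((Equiv.Perm.sign σ : ℤ)) : MvPolynomial (Fin n ⊕ Fin n) ℚ) =
      C ((Equiv.Perm.sign σ : ℤ) : ℚ) := by simp
  rw [h1, h2, coeff_C_mul, coeff_monomial]
  by_cases hu : u = fun r => (e (σ.symm r)).1
  · subst hu
    have h3 : facD (fu fun r => (e (σ.symm r)).1) = facD (fu fun k => (e k).1) := by
      simp only [facD, Fintype.prod_sum_type, fu_inl, fu_inr]
      rw [Equiv.prod_comp σ.symm (fun k => ((e k).1.1.factorial : ℚ)),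
        Equiv.prod_comp σ.symm (fun k => ((e k).1.2.factorial : ℚ))]
    rw [h3]
    simp
  · rw [if_neg (fun h => hu (fu_inj h).symm)]
    have : ∃ j, u (σ j) ≠ (e j).1 := by
      by_contra hne
      push Not at hne
      apply hu
      funext r
      simpa using hne (σ.symm r)
    obtain ⟨j, hj⟩ := this
    rw [Finset.prod_eq_zero (Finset.mem_univ j) (by simp [hj])]
    simp

lemma Ns_smul {n : ℕ} (F : UU n → ℚ) (a : ℚ) (ha : a ≠ 0) : Ns (a • F) = Ns F := by
  apply le_antisymm
  · apply Submodule.span_le.2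
    rintro _ ⟨v, rfl⟩
    exact Submodule.smul_mem _ a (Ns_gen F v)
  · apply Submodule.span_le.2
    rintro _ ⟨v, rfl⟩
    have := Submodule.smul_mem _ a⁻¹ (Ns_gen (a • F) v)
    have h2 : (a⁻¹ • fun u => (a • F) (u + v)) = fun u => F (u + v) := by
      funext u
      simp [ha]
    rw [h2] at this
    exact this

lemma map_GH {n : ℕ} (cells : Finset (ℕ × ℕ)) (e : Fin n ≃ {c // c ∈ cells}) :
    (GHmodule n cells e).map (Psi n) = Ns (AA fun k => (e k).1) := by
  rw [GHmodule, map_derivSpan, Psi_Delta, Ns_smul _ _ (facD_ne _)]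

lemma finrank_GH {n : ℕ} (cells : Finset (ℕ × ℕ)) (e : Fin n ≃ {c // c ∈ cells}) :
    Module.finrank ℚ (GHmodule n cells e) = Module.finrank ℚ (Ns (AA fun k => (e k).1)) := by
  rw [← map_GH]
  exact (LinearEquiv.finrank_eq (Submodule.equivMapOfInjective (Psi n) (Psi_inj n) _))

lemma finrank_bi {n : ℕ} (cells : Finset (ℕ × ℕ)) (e : Fin n ≃ {c // c ∈ cells}) (h k : ℤ) :
    Set.finrank ℚ (biComponent n h k ↑(GHmodule n cells e)) =
      Module.finrank ℚ (Ns (AA fun k => (e k).1) ⊓ Bsub n (h, k) : Submodule ℚ _) := by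
  have h1 : biComponent n h k ↑(GHmodule n cells e) =
      ((GHmodule n cells e ⊓ (Bsub n (h, k)).comap (Psi n) : Submodule ℚ _) : Set _) := by
    ext P
    simp only [biComponent, Set.mem_ofPred_eq, SetLike.mem_coe, Submodule.mem_inf,
      Submodule.mem_comap]
    apply and_congr_right
    intro _
    constructor
    · intro H u hu
      have := H (fu u) (right_ne_zero_of_mul hu)
      simp only [xdeg, ydeg, fu_inl, fu_inr] at this
      push_cast at this
      exact Prod.ext this.1 this.2
    · intro H d hd
      have := H (fun r => (d (Sum.inl r), d (Sum.inr r))) (by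
        rw [Psi_apply, fu_surj]; exact mul_ne_zero (facD_ne _) hd)
      rw [bideg, Prod.mk.injEq] at this
      simp only [xdeg, ydeg]
      push_cast
      exact this
  have h2 : (GHmodule n cells e ⊓ (Bsub n (h, k)).comap (Psi n)).map (Psi n) =
      Ns (AA fun k => (e k).1) ⊓ Bsub n (h, k) := by
    rw [← map_GH]
    ext f
    constructor
    · rintro ⟨P, ⟨h1, h2⟩, rfl⟩
      exact ⟨⟨P, h1, rfl⟩, h2⟩
    · rintro ⟨⟨P, h1, rfl⟩, h2⟩
      exact ⟨P, ⟨h1, h2⟩, rfl⟩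
  rw [Set.finrank, h1, Submodule.span_eq, ← h2]
  exact (LinearEquiv.finrank_eq (Submodule.equivMapOfInjective (Psi n) (Psi_inj n) _))

lemma final_aux {r s N : ℕ} (hr : 2 ≤ r) (hs : 1 ≤ s) (hN : r * s = N)
    (eμ : Fin N ≃ {c // c ∈ Finset.range s ×ˢ Finset.range r})
    (eν : Fin (N - 1) ≃
      {c // c ∈ (Finset.range s ×ˢ Finset.range r).erase (s - 1, r - 1)})
    (hν : Module.finrank ℚ ↥(GHmodule (N - 1)
        ((Finset.range s ×ˢ Finset.range r).erase (s - 1, r - 1)) eν) =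
      Nat.factorial (N - 1)) (h k : ℤ) :
      Set.finrank ℚ (biComponent N h k
          ↑(GHmodule N (Finset.range s ×ˢ Finset.range r) eμ)) =
        ∑ i ∈ Finset.range s, ∑ j ∈ Finset.range r,
          Set.finrank ℚ (biComponent (N - 1) (h - (i : ℤ)) (k - (j : ℤ))
            ↑(GHmodule (N - 1)
              ((Finset.range s ×ˢ Finset.range r).erase (s - 1, r - 1)) eν)) := by
  rw [finrank_GH] at hν
  simp only [finrank_bi]
  obtain ⟨m, rfl⟩ : ∃ m, N = m + 1 := by
    have : 0 < r * s := by positivity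
    exact ⟨N - 1, by omega⟩
  have := main_fun (m := m) (by omega) hs hN eμ eν hν (h, k)
  rw [Finset.sum_product] at this
  exact this

/-- If the `n!`-conjecture holds for `ν = (r-1, r^{s-1})`, then the bigraded
Hilbert series of `M_μ`, for the rectangle `μ = r^s`, satisfies
`G_μ(q,t) = B_μ(q,t) · G_ν(q,t)` with
`B_μ(q,t) = (1 + t + ⋯ + t^{s-1})(1 + q + ⋯ + q^{r-1})`, stated here
coefficientwise: the coefficient of `t^h q^k` in `G_μ` is the sum over the
cells `(i,j)` of the `s × r` rectangle of the coefficients of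
`t^{h-i} q^{k-j}` in `G_ν`. -/
theorem statement1 (r s : ℕ) (hr : 2 ≤ r) (hs : 1 ≤ s)
    (eμ : Fin (r * s) ≃ {c // c ∈ Finset.range s ×ˢ Finset.range r})
    (eν : Fin (r * s - 1) ≃
      {c // c ∈ (Finset.range s ×ˢ Finset.range r).erase (s - 1, r - 1)})
    (hν : Module.finrank ℚ ↥(GHmodule (r * s - 1)
        ((Finset.range s ×ˢ Finset.range r).erase (s - 1, r - 1)) eν) =
      Nat.factorial (r * s - 1)) :
    ∀ h k : ℤ,
      Set.finrank ℚ (biComponent (r * s) h k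
          ↑(GHmodule (r * s) (Finset.range s ×ˢ Finset.range r) eμ)) =
        ∑ i ∈ Finset.range s, ∑ j ∈ Finset.range r,
          Set.finrank ℚ (biComponent (r * s - 1) (h - (i : ℤ)) (k - (j : ℤ))
            ↑(GHmodule (r * s - 1)
              ((Finset.range s ×ˢ Finset.range r).erase (s - 1, r - 1)) eν)) := by
  exact final_aux hr hs rfl eμ eν hν
end

section
/- Let k ≥ 1 and let y_1,…,y_k be pairwise distinct nonzero integers. Then, as the real number q tends to 1 through positive values q ≠ 1, the quantity (1−q)·Σ_{s=1}^{k} ( ∏_{r≠s} q^{y_s}/(q^{y_s} − q^{y_r}) )·( y_s/(1 − q^{y_s}) ) tends to 1/k. -/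
open Filter

/-- Partial fraction identity from Lagrange interpolation of `X^(k-1)`. -/
lemma dd_identity (k : ℕ) (hk : 1 ≤ k) (x : Fin k → ℝ) (hinj : Function.Injective x)
    (a v : ℝ) (hv : v ≠ 0) (hne : ∀ r, a + v * x r ≠ 0) :
    ∑ s, (∏ r ∈ Finset.univ.erase s, x s / (x s - x r)) * (1 / (a + v * x s))
      = a ^ (k - 1) / ∏ r, (a + v * x r) := by
  have h1 : (Polynomial.X ^ (k - 1) : Polynomial ℝ)
      = Lagrange.interpolate Finset.univ x
          (fun i => (Polynomial.X ^ (k - 1) : Polynomial ℝ).eval (x i)) := by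
    apply Lagrange.eq_interpolate (hinj.injOn)
    rw [Polynomial.degree_X_pow]
    simp only [Finset.card_univ, Fintype.card_fin]
    exact_mod_cast (by omega : k - 1 < k)
  have h2 := congrArg (Polynomial.eval (-a / v)) h1
  rw [Lagrange.interpolate_apply, Polynomial.eval_finset_sum] at h2
  simp only [Polynomial.eval_mul, Polynomial.eval_C, Polynomial.eval_pow, Polynomial.eval_X,
    Lagrange.basis, Polynomial.eval_prod, Lagrange.basisDivisor, Polynomial.eval_sub] at h2
  have hP : ∏ r, (a + v * x r) ≠ 0 := Finset.prod_ne_zero_iff.mpr (fun r _ => hne r)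
  have hcard : ∀ s : Fin k, (Finset.univ.erase s).card = k - 1 := by
    intro s; simp [Finset.card_erase_of_mem]
  rw [eq_div_iff hP, Finset.sum_mul]
  have h3 : a ^ (k - 1) = (-v) ^ (k - 1) * (-a / v) ^ (k - 1) := by
    rw [← mul_pow]; congr 1; field_simp
  rw [h3, h2, Finset.mul_sum]
  refine Finset.sum_congr rfl fun s _ => ?_
  rw [← Finset.mul_prod_erase _ _ (Finset.mem_univ s), ← hcard s, ← Finset.prod_const,
    ← Finset.prod_const]
  have : ∀ A B C : ℝ, C ≠ 0 → A * (1 / C) * (C * B) = A * B := by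
    intro A B C hC; field_simp
  rw [this _ _ _ (hne s), ← Finset.prod_mul_distrib, ← Finset.prod_mul_distrib,
    ← Finset.prod_mul_distrib]
  refine Finset.prod_congr rfl fun r hr => ?_
  have hd : x s - x r ≠ 0 := sub_ne_zero.mpr fun h => (Finset.ne_of_mem_erase hr) (hinj h).symm
  field_simp
  ring

lemma seg_pos {x v : ℝ} (hx : 0 < x) (h0 : 0 ≤ v) (h1 : v ≤ 1) : 0 < (1 - v) + v * x := by
  rcases eq_or_lt_of_le h1 with h | h
  · subst h; simpa using hx
  · have := mul_nonneg h0 hx.le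
    linarith

lemma log_integral (x : ℝ) (hx : 0 < x) (hx1 : x ≠ 1) :
    ∫ v in (0:ℝ)..1, 1 / ((1 - v) + v * x) = Real.log x / (x - 1) := by
  have h : x - 1 ≠ 0 := sub_ne_zero.mpr hx1
  have := intervalIntegral.integral_comp_mul_add (a := 0) (b := 1) (fun t : ℝ => t⁻¹) h 1
  rw [integral_inv_of_pos (by simp) (by simpa using hx)] at this
  simp only [smul_eq_mul, mul_zero, zero_add, mul_one, sub_add_cancel, div_one] at this
  rw [div_eq_inv_mul, ← this]
  congr 1
  funext v
  rw [one_div]; congr 1; ring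

lemma cont_seg (x : ℝ) (hx : 0 < x) :
    ContinuousOn (fun v : ℝ => 1 / ((1 - v) + v * x)) (Set.uIcc 0 1) := by
  rw [Set.uIcc_of_le zero_le_one]
  refine ContinuousOn.div (by fun_prop) (by fun_prop) fun v hv => (seg_pos hx hv.1 hv.2).ne'

lemma sum_integral (k : ℕ) (hk : 1 ≤ k) (x : Fin k → ℝ) (hinj : Function.Injective x)
    (hx : ∀ r, 0 < x r) (hx1 : ∀ r, x r ≠ 1) :
    ∑ s, (∏ r ∈ Finset.univ.erase s, x s / (x s - x r)) * (Real.log (x s) / (x s - 1))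
      = ∫ v in (0:ℝ)..1, (1 - v) ^ (k - 1) / ∏ r, ((1 - v) + v * x r) := by
  have : ∫ v in (0:ℝ)..1, (1 - v) ^ (k - 1) / ∏ r, ((1 - v) + v * x r)
      = ∫ v in (0:ℝ)..1, ∑ s, (∏ r ∈ Finset.univ.erase s, x s / (x s - x r)) *
          (1 / ((1 - v) + v * x s)) := by
    refine intervalIntegral.integral_congr_ae (Eventually.of_forall fun v hv => ?_)
    rw [Set.uIoc_of_le zero_le_one] at hv
    exact (dd_identity k hk x hinj (1 - v) v hv.1.ne'
      fun r => (seg_pos (hx r) hv.1.le hv.2).ne').symm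
  rw [this, intervalIntegral.integral_finset_sum]
  · refine Finset.sum_congr rfl fun s _ => ?_
    rw [intervalIntegral.integral_const_mul, log_integral _ (hx s) (hx1 s)]
  · intro s _
    exact ((cont_seg _ (hx s)).intervalIntegrable).const_mul _

lemma int_tendsto (k : ℕ) (hk : 1 ≤ k) (y : Fin k → ℤ) :
    Tendsto (fun q : ℝ => ∫ v in (0:ℝ)..1, (1 - v) ^ (k - 1) / ∏ r, ((1 - v) + v * q ^ (y r)))
      (nhdsWithin 1 (Set.Ioi (0 : ℝ) \ {1})) (nhds (1 / (k : ℝ))) := by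
  have hlim : ∫ v in (0:ℝ)..1, (1 - v) ^ (k - 1) = 1 / (k : ℝ) := by
    rw [intervalIntegral.integral_comp_sub_left (fun t : ℝ => t ^ (k - 1)) 1, integral_pow]
    have : ((k - 1 : ℕ) : ℝ) + 1 = k := by
      rw [Nat.cast_sub hk]; simp
    rw [this, Nat.sub_add_cancel hk]
    simp [show k ≠ 0 by omega]
  rw [← hlim]
  have hz : ∀ r, Tendsto (fun q : ℝ => q ^ (y r)) (nhdsWithin 1 (Set.Ioi (0 : ℝ) \ {1}))
      (nhds 1) := by
    intro r
    have := (continuousAt_zpow₀ (1:ℝ) (y r) (Or.inl one_ne_zero)).tendsto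
    rw [one_zpow] at this
    exact this.mono_left nhdsWithin_le_nhds
  have hev : ∀ᶠ q : ℝ in nhdsWithin 1 (Set.Ioi (0 : ℝ) \ {1}), ∀ r, 1 / 2 < q ^ (y r) :=
    eventually_all.mpr fun r => (hz r).eventually (lt_mem_nhds (by norm_num))
  refine intervalIntegral.tendsto_integral_filter_of_dominated_convergence
    (fun _ => (2:ℝ) ^ k) ?_ ?_ ?_ ?_
  · refine Eventually.of_forall fun q => Measurable.aestronglyMeasurable ?_
    fun_prop
  · filter_upwards [hev] with q hq
    refine Eventually.of_forall fun v hv => ?_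
    rw [Set.uIoc_of_le zero_le_one] at hv
    have hb : ∀ r, 1 / 2 ≤ (1 - v) + v * q ^ (y r) := by
      intro r
      nlinarith [hq r, hv.1, hv.2]
    have hp : (1 / 2 : ℝ) ^ k ≤ ∏ r, ((1 - v) + v * q ^ (y r)) := by
      have := Finset.prod_le_prod (s := (Finset.univ : Finset (Fin k)))
        (f := fun _ => (1 / 2 : ℝ)) (fun _ _ => by norm_num) (fun r _ => hb r)
      simpa using this
    have hpos : (0:ℝ) < (1 / 2 : ℝ) ^ k := by positivity
    have h1v : 0 ≤ 1 - v := by linarith [hv.2]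
    rw [Real.norm_of_nonneg (div_nonneg (pow_nonneg h1v _) (hpos.le.trans hp))]
    rw [div_le_iff₀ (hpos.trans_le hp)]
    calc (1 - v) ^ (k - 1) ≤ 1 := pow_le_one₀ h1v (by linarith [hv.1])
      _ = 2 ^ k * (1 / 2 : ℝ) ^ k := by rw [← mul_pow]; norm_num
      _ ≤ _ := by gcongr
  · exact intervalIntegrable_const
  · refine Eventually.of_forall fun v _ => ?_
    have h : Tendsto (fun q : ℝ => (1 - v) ^ (k - 1) / ∏ r, ((1 - v) + v * q ^ (y r)))
        (nhdsWithin 1 (Set.Ioi (0 : ℝ) \ {1}))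
        (nhds ((1 - v) ^ (k - 1) / ∏ r : Fin k, ((1 - v) + v * 1))) := by
      refine Tendsto.div tendsto_const_nhds
        (tendsto_finset_prod _ fun r _ => ((hz r).const_mul v).const_add _) ?_
      simp
    simpa using h

lemma slope_tendsto : Tendsto (fun q : ℝ => (q - 1) / Real.log q)
    (nhdsWithin 1 (Set.Ioi (0 : ℝ) \ {1})) (nhds 1) := by
  have h := (hasDerivAt_iff_tendsto_slope.mp (Real.hasDerivAt_log (one_ne_zero)))
  have h2 := (h.inv₀ (by simp)).mono_left
    (nhdsWithin_mono (1:ℝ) (fun q (hq : q ∈ Set.Ioi (0 : ℝ) \ {1}) => hq.2))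
  simpa [slope_def_field] using h2

/-- Lemma 3.1 of Bergeron–Garsia: for pairwise distinct nonzero integers
`y_1, …, y_k`, as `q → 1` through positive values `q ≠ 1`,
`(1-q) ∑_{s=1}^k ( ∏_{r≠s} q^{y_s}/(q^{y_s} - q^{y_r}) ) · y_s/(1 - q^{y_s})`
tends to `1/k`. -/
theorem statement14 (k : ℕ) (hk : 1 ≤ k) (y : Fin k → ℤ)
    (hy0 : ∀ s, y s ≠ 0) (hyinj : Function.Injective y) :
    Tendsto
      (fun q : ℝ => (1 - q) *
        ∑ s, (∏ r ∈ Finset.univ.erase s, q ^ (y s) / (q ^ (y s) - q ^ (y r))) *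
          ((y s : ℝ) / (1 - q ^ (y s))))
      (nhdsWithin 1 (Set.Ioi (0 : ℝ) \ {1}))
      (nhds (1 / (k : ℝ))) := by
  have h := slope_tendsto.mul (int_tendsto k hk y)
  rw [one_mul] at h
  refine h.congr' ?_
  filter_upwards [self_mem_nhdsWithin] with q hq
  have hq0 : 0 < q := hq.1
  have hq1 : q ≠ 1 := hq.2
  have hzi := zpow_right_injective₀ hq0 hq1
  have hne1 : ∀ r, q ^ (y r) ≠ 1 := fun r hr => hy0 r (hzi (by simpa using hr))
  have hlog : Real.log q ≠ 0 := Real.log_ne_zero_of_pos_of_ne_one hq0 hq1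
  rw [← sum_integral k hk (fun r => q ^ (y r)) (hzi.comp hyinj) (fun r => zpow_pos hq0 _) hne1,
    Finset.mul_sum, Finset.mul_sum]
  refine Finset.sum_congr rfl fun s _ => ?_
  have hs : q ^ (y s) - 1 ≠ 0 := sub_ne_zero.mpr (hne1 s)
  have hs' : 1 - q ^ (y s) ≠ 0 := sub_ne_zero.mpr (hne1 s).symm
  rw [Real.log_zpow]
  have : (q - 1) / Real.log q * ((y s : ℝ) * Real.log q / (q ^ (y s) - 1))
      = (1 - q) * ((y s : ℝ) / (1 - q ^ (y s))) := by
    rw [← neg_sub 1 (q ^ (y s))]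
    field_simp
    ring
  rw [mul_left_comm, this, mul_left_comm]
end
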